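/- For every dense G_δ-set G in I^ω and every F_σ-set F ⊆ I^ω of finite covering dimension at most k, the set H^{k+4}_{F,G} = {(h₁,…,h_{k+4}) ∈ H(I^ω)^{k+4} : F ⊆ h₁(G) ∪ … ∪ h_{k+4}(G)} is a dense G_δ-set in H(I^ω)^{k+4}. -/

import Mathlib

open Set Topology Cardinal

/-- The Hilbert cube `[0,1]^ℕ` with the product topology. -/
abbrev HilbertCube : Type := ℕ → ↥(Set.Icc (0:ℝ) 1)

/-- An ideal of subsets: a nonempty family closed under subsets and finite unions. -/
def IsIdeal {X : Type*} (I : Set (Set X)) : Prop :=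
  I.Nonempty ∧ (∀ A ∈ I, ∀ B, B ⊆ A → B ∈ I) ∧ (∀ A ∈ I, ∀ B ∈ I, A ∪ B ∈ I)

/-- A σ-ideal: an ideal closed under countable unions. -/
def IsSigmaIdeal {X : Type*} (I : Set (Set X)) : Prop :=
  IsIdeal I ∧ ∀ A : ℕ → Set X, (∀ n, A n ∈ I) → (⋃ n, A n) ∈ I

/-- A non-trivial ideal contains an uncountable set but not the whole space. -/
def NontrivialIdeal {X : Type*} (I : Set (Set X)) : Prop :=
  (∃ A ∈ I, ¬ A.Countable) ∧ Set.univ ∉ I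

/-- An ideal on a topological space is topologically invariant if it is preserved by
all homeomorphisms of the space. -/
def TopInvariant {X : Type*} [TopologicalSpace X] (I : Set (Set X)) : Prop :=
  ∀ h : X ≃ₜ X, {B | ∃ A ∈ I, B = h '' A} = I

/-- `I` has a base all of whose members satisfy `P`. -/
def HasBaseWith {X : Type*} (I : Set (Set X)) (P : Set X → Prop) : Prop :=
  ∃ B ⊆ I, (∀ A ∈ I, ∃ C ∈ B, A ⊆ C) ∧ ∀ C ∈ B, P C

/-- A set has the Baire property if it differs from some open set by a meager set. -/
def HasBaireProperty {X : Type*} [TopologicalSpace X] (A : Set X) : Prop :=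
  ∃ U : Set X, IsOpen U ∧ IsMeagre ((A \ U) ∪ (U \ A))

/-- The σ-ideal of meager subsets of a topological space. -/
def MeagerIdeal (X : Type*) [TopologicalSpace X] : Set (Set X) := {A | IsMeagre A}

/-- The σ-ideal generated by a family `F`: all subsets of countable unions of members
of `F`. -/
def sigmaGenerated {X : Type*} (F : Set (Set X)) : Set (Set X) :=
  {A | ∃ S : ℕ → Set X, (∀ n, S n ∈ F) ∧ A ⊆ ⋃ n, S n}

/-- A Cantor set in the Hilbert cube: a subset homeomorphic to the Cantor cube. -/
def IsCantorSet (C : Set HilbertCube) : Prop := Nonempty (C ≃ₜ (ℕ → Bool))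

/-- A minimal Cantor set: one that can be mapped into any other Cantor set by an
ambient homeomorphism. -/
def IsMinimalCantorSet (A : Set HilbertCube) : Prop :=
  IsCantorSet A ∧ ∀ B : Set HilbertCube, IsCantorSet B →
    ∃ h : HilbertCube ≃ₜ HilbertCube, h '' A ⊆ B

/-- The family of all minimal Cantor sets in the Hilbert cube. -/
def CantorFamily : Set (Set HilbertCube) := {A | IsMinimalCantorSet A}

/-- The σ-ideal generated by minimal Cantor sets. -/
def sigmaC0 : Set (Set HilbertCube) := sigmaGenerated CantorFamily

/-- A minimal dense Gδ-subset of the Hilbert cube. -/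
def IsMinimalDenseGdelta (A : Set HilbertCube) : Prop :=
  IsGδ A ∧ Dense A ∧ ∀ B : Set HilbertCube, IsGδ B → Dense B →
    ∃ h : HilbertCube ≃ₜ HilbertCube, h '' A ⊆ B

/-- The family of all minimal dense Gδ-sets in the Hilbert cube. -/
def GdeltaFamily : Set (Set HilbertCube) := {A | IsMinimalDenseGdelta A}

/-- The σ-ideal generated by minimal dense Gδ-sets. -/
def sigmaG0 : Set (Set HilbertCube) := sigmaGenerated GdeltaFamily

/-- `cov(I)`: the least cardinality of a subfamily of `I` covering the space. -/
noncomputable def covIdeal {X : Type*} (I : Set (Set X)) : Cardinal :=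
  sInf {c | ∃ A : Set (Set X), A ⊆ I ∧ ⋃₀ A = Set.univ ∧ c = #A}

/-- `non(I)`: the least cardinality of a subset of the space not in `I`. -/
noncomputable def nonIdeal {X : Type*} (I : Set (Set X)) : Cardinal :=
  sInf {c | ∃ A : Set X, A ∉ I ∧ c = #A}

/-- `add(I,J)`: the least cardinality of a subfamily of `I` whose union is not in `J`. -/
noncomputable def addIdeal2 {X : Type*} (I J : Set (Set X)) : Cardinal :=
  sInf {c | ∃ A : Set (Set X), A ⊆ I ∧ ⋃₀ A ∉ J ∧ c = #A}

/-- `add(I) = add(I,I)`. -/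
noncomputable def addIdeal {X : Type*} (I : Set (Set X)) : Cardinal := addIdeal2 I I

/-- `cof(I,J)`: the least cardinality of a subfamily of `J` cofinal in `I`. -/
noncomputable def cofIdeal2 {X : Type*} (I J : Set (Set X)) : Cardinal :=
  sInf {c | ∃ A : Set (Set X), A ⊆ J ∧ (∀ B ∈ I, ∃ C ∈ A, B ⊆ C) ∧ c = #A}

/-- `cof(I) = cof(I,I)`. -/
noncomputable def cofIdeal {X : Type*} (I : Set (Set X)) : Cardinal := cofIdeal2 I I

/-- The compact-open topology on the homeomorphism group of a space, induced by the
compact-open topology of the space of continuous self-maps. -/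
noncomputable instance homeoGroupTopology (X : Type*) [TopologicalSpace X] :
    TopologicalSpace (X ≃ₜ X) :=
  TopologicalSpace.induced (fun h : X ≃ₜ X => (⟨h, h.continuous⟩ : C(X, X)))
    ContinuousMap.compactOpen

/-- A Z-set: a closed set `A` such that for every open cover `U` of the space there is a
continuous map into the complement of `A` which is `U`-near to the identity. -/
def IsZSet {X : Type*} [TopologicalSpace X] (A : Set X) : Prop :=
  IsClosed A ∧ ∀ U : Set (Set X), (∀ V ∈ U, IsOpen V) → ⋃₀ U = Set.univ →
    ∃ f : C(X, X), (∀ x, f x ∉ A) ∧ ∀ x : X, ∃ V ∈ U, x ∈ V ∧ f x ∈ V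

/-- A σZ-set: a countable union of Z-sets. -/
def IsSigmaZSet {X : Type*} [TopologicalSpace X] (A : Set X) : Prop :=
  ∃ Z : ℕ → Set X, (∀ n, IsZSet (Z n)) ∧ A = ⋃ n, Z n

/-- The cube `[0,1]^n`. -/
abbrev FinCube (n : ℕ) : Type := Fin n → ↥(Set.Icc (0:ℝ) 1)

/-- A `Z_n`-set in the Hilbert cube: a closed set `A` such that maps avoiding `A` are
dense in the space `C([0,1]^n, I^ω)` with the compact-open topology. -/
def IsZnSet (n : ℕ) (A : Set HilbertCube) : Prop :=
  IsClosed A ∧ Dense {f : C(FinCube n, HilbertCube) | ∀ x, f x ∉ A}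

/-- A `Z_ω`-set in the Hilbert cube: a closed set which is a `Z_n`-set for all `n`. -/
def IsZomegaSet (A : Set HilbertCube) : Prop :=
  IsClosed A ∧ ∀ n : ℕ, IsZnSet n A

/-- Covering dimension of a space is at most `n`: every finite open cover has a finite
open refinement (still a cover) in which no point belongs to more than `n+1` members. -/
def CovDimLE (Y : Type*) [TopologicalSpace Y] (n : ℕ) : Prop :=
  ∀ U : Set (Set Y), U.Finite → (∀ V ∈ U, IsOpen V) → ⋃₀ U = Set.univ →
    ∃ V : Set (Set Y), V.Finite ∧ (∀ W ∈ V, IsOpen W) ∧ ⋃₀ V = Set.univ ∧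
      (∀ W ∈ V, ∃ W' ∈ U, W ⊆ W') ∧
      ∀ y : Y, {W ∈ V | y ∈ W}.ncard ≤ n + 1

/-- A `G_δ`-generated topologically invariant ideal on the Hilbert cube. -/
def GdeltaGenerated (I : Set (Set HilbertCube)) : Prop :=
  HasBaseWith I IsSigmaCompact ∧
  ∃ G : Set HilbertCube, IsGδ G ∧
    (∀ K : Set HilbertCube, K ⊆ G → IsCompact K → K ∈ I) ∧
    ∀ A ∈ I, IsCompact A →
      Dense {h : HilbertCube ≃ₜ HilbertCube | h '' A ⊆ G}

/-- A `G_δ*`-generated ideal: a preimage of a `G_δ`-generated ideal under an embedding. -/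
def GdeltaStarGenerated (I : Set (Set HilbertCube)) : Prop :=
  ∃ I' : Set (Set HilbertCube), GdeltaGenerated I' ∧
    ∃ e : HilbertCube → HilbertCube, IsEmbedding e ∧ I = {S | ∃ A ∈ I', S = e ⁻¹' A}

/-- A `σG_δ*`-generated ideal. -/
def SigmaGdeltaStarGenerated (I : Set (Set HilbertCube)) : Prop :=
  ∃ In : ℕ → Set (Set HilbertCube), (∀ n, GdeltaStarGenerated (In n)) ∧
    (∀ n, In n ⊆ I) ∧
    ∀ A ∈ I, ∃ K : ℕ → Set HilbertCube,
      (∀ n, IsCompact (K n) ∧ K n ∈ In n) ∧ A ⊆ ⋃ n, K n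

section HomeoTop
variable {X : Type*} [TopologicalSpace X]

/-- A homeomorphism as a continuous self-map. -/
def homeoToCM (h : X ≃ₜ X) : C(X, X) := ⟨h, h.continuous⟩

theorem isInducing_homeoToCM : IsInducing (homeoToCM : (X ≃ₜ X) → C(X, X)) := ⟨rfl⟩

theorem continuous_homeo_eval [LocallyCompactSpace X] :
    Continuous fun p : (X ≃ₜ X) × X => p.1 p.2 := by
  have h1 : Continuous fun p : (X ≃ₜ X) × X => (homeoToCM p.1, p.2) :=
    (isInducing_homeoToCM.continuous.comp continuous_fst).prodMk continuous_snd
  exact (ContinuousEval.continuous_eval (F := C(X, X))).comp h1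

variable [CompactSpace X] [T2Space X]

theorem isOpen_cover_by_images {n : ℕ} {C : Set X} (hC : IsClosed C) {U : Set X} (hU : IsOpen U) :
    IsOpen {h : Fin n → X ≃ₜ X | C ⊆ ⋃ i, h i '' U} := by
  let S : Set ((Fin n → X ≃ₜ X) × (X × (Fin n → X))) :=
    {p | p.2.1 ∈ C ∧ ∀ i, p.2.2 i ∈ Uᶜ ∧ p.1 i (p.2.2 i) = p.2.1}
  have hS : IsClosed S := by
    have : S = (fun p => p.2.1) ⁻¹' C ∩ ⋂ i, ((fun p => p.2.2 i) ⁻¹' Uᶜ ∩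
        {p | p.1 i (p.2.2 i) = p.2.1}) := by
      ext p; simp [S]
    rw [this]
    refine (hC.preimage (by fun_prop)).inter (isClosed_iInter fun i =>
      (hU.isClosed_compl.preimage (by fun_prop)).inter (isClosed_eq ?_ (by fun_prop)))
    exact continuous_homeo_eval.comp
      (f := fun p : (Fin n → X ≃ₜ X) × (X × (Fin n → X)) => (p.1 i, p.2.2 i)) (by fun_prop)
  have h2 := isClosedMap_fst_of_compactSpace S hS
  rw [← isClosed_compl_iff]
  convert h2 using 1
  ext h
  simp only [mem_compl_iff, mem_ofPred_eq, not_subset, mem_iUnion, mem_image, not_exists, not_and,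
    Prod.exists, exists_and_right, exists_eq_right, S]
  constructor
  · rintro ⟨x, hx, hn⟩
    exact ⟨x, fun i => (h i).symm x, hx, fun i => ⟨fun hu => hn i _ hu (by simp), by simp⟩⟩
  · rintro ⟨x, y, hx, hy⟩
    refine ⟨x, hx, fun i z hz hzx => (hy i).1 ?_⟩
    have : y i = z := (h i).injective ((hy i).2.trans hzx.symm)
    rwa [this]

theorem continuous_homeo_symm : Continuous (fun h : X ≃ₜ X => h.symm) := by
  rw [isInducing_homeoToCM.continuous_iff, ContinuousMap.continuous_compactOpen]
  intro K hK V hV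
  let S : Set ((X ≃ₜ X) × X) := {p | p.1 p.2 ∈ K ∧ p.2 ∈ Vᶜ}
  have hS : IsClosed S :=
    (hK.isClosed.preimage continuous_homeo_eval).inter (hV.isClosed_compl.preimage continuous_snd)
  have h2 := isClosedMap_fst_of_compactSpace S hS
  rw [← isClosed_compl_iff]
  convert h2 using 1
  ext h
  simp only [mem_compl_iff, mem_ofPred_eq, MapsTo, not_forall, Function.comp, homeoToCM,
    ContinuousMap.coe_mk, mem_image, Prod.exists, exists_and_right, exists_eq_right, S]
  constructor
  · rintro ⟨x, hx, hn⟩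
    exact ⟨h.symm x, by simpa using hx, hn⟩
  · rintro ⟨x, hx, hn⟩
    exact ⟨h x, hx, by simpa using hn⟩

theorem homeo_isCompletelyMetrizable [TopologicalSpace.IsCompletelyMetrizableSpace C(X, X)] :
    TopologicalSpace.IsCompletelyMetrizableSpace (X ≃ₜ X) := by
  let j : (X ≃ₜ X) → C(X, X) × C(X, X) := fun h => (homeoToCM h, homeoToCM h.symm)
  have hj : Continuous j := isInducing_homeoToCM.continuous.prodMk
    (isInducing_homeoToCM.continuous.comp continuous_homeo_symm)
  have hind : IsInducing j := by
    refine IsInducing.of_comp hj continuous_fst ?_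
    exact isInducing_homeoToCM
  have hinj : Function.Injective j := by
    intro a b hab
    ext x
    exact DFunLike.congr_fun (congrArg Prod.fst hab) x
  have hr : range j = {p | p.1.comp p.2 = ContinuousMap.id X ∧
      p.2.comp p.1 = ContinuousMap.id X} := by
    ext ⟨f, g⟩
    constructor
    · rintro ⟨h, hh⟩
      rw [← hh]
      constructor <;> ext x <;> simp [j, homeoToCM]
    · rintro ⟨h1, h2⟩
      refine ⟨⟨⟨f, g, fun x => DFunLike.congr_fun h2 x, fun x => DFunLike.congr_fun h1 x⟩,
        f.continuous, g.continuous⟩, ?_⟩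
      rfl
  have hcl : IsClosed (range j) := by
    rw [hr]
    refine (isClosed_eq ?_ continuous_const).inter (isClosed_eq ?_ continuous_const)
    · exact ContinuousMap.continuous_comp'.comp continuous_swap
    · exact ContinuousMap.continuous_comp'
  exact IsClosedEmbedding.IsCompletelyMetrizableSpace ⟨⟨hind, hinj⟩, hcl⟩
end HomeoTop

theorem tendsto_homeo_of_dist_le {α : ℕ → HilbertCube ≃ₜ HilbertCube}
    {h : HilbertCube ≃ₜ HilbertCube}
    (H : ∀ N x i, i < N → dist (h x i) (α N x i) ≤ 1 / ((N : ℝ) + 1)) :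
    Filter.Tendsto α Filter.atTop (𝓝 h) := by
  rw [isInducing_homeoToCM.tendsto_nhds_iff, ContinuousMap.tendsto_iff_tendstoUniformly,
    tendstoUniformly_iff_tendsto, Pi.uniformity, Filter.tendsto_iInf]
  intro i
  rw [Filter.tendsto_comap_iff, tendsto_uniformity_iff_dist_tendsto_zero]
  have hz : Filter.Tendsto (fun p : ℕ × HilbertCube => 1 / ((p.1 : ℝ) + 1))
      (Filter.atTop ×ˢ ⊤) (𝓝 0) :=
    tendsto_one_div_add_atTop_nhds_zero_nat.comp Filter.tendsto_fst
  refine squeeze_zero' (Filter.Eventually.of_forall fun _ => dist_nonneg) ?_ hz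
  filter_upwards [Filter.tendsto_fst.eventually (Filter.eventually_gt_atTop i)] with p hp
  exact H p.1 p.2 i hp

theorem dense_cover_of_approx {n : ℕ} {C : Set HilbertCube}
    (approx : ∀ U : Fin n → Set HilbertCube, (∀ e, IsOpen (U e)) → (∀ e, Dense (U e)) →
      ∀ (m : ℕ) (ε : ℝ), 0 < ε → ∃ g : Fin n → HilbertCube ≃ₜ HilbertCube,
        (∀ e q i, i < m → dist (g e q i) (q i) ≤ ε) ∧ C ⊆ ⋃ e, g e ⁻¹' U e)
    {U : Set HilbertCube} (hU : IsOpen U) (hd : Dense U) :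
    Dense {h : Fin n → HilbertCube ≃ₜ HilbertCube | C ⊆ ⋃ i, h i '' U} := by
  intro h₀
  have key := fun N : ℕ => approx (fun e => h₀ e '' U) (fun e => (h₀ e).isOpenMap _ hU)
    (fun e => (h₀ e).surjective.denseRange.dense_image (h₀ e).continuous hd) N (1 / ((N : ℝ) + 1)) (by positivity)
  choose g hg hgC using key
  refine mem_closure_of_tendsto (f := fun N e => (h₀ e).trans (g N e).symm)
    (b := Filter.atTop) ?_ (Filter.Eventually.of_forall fun N x hx => ?_)
  · rw [tendsto_pi_nhds]
    intro e
    refine tendsto_homeo_of_dist_le fun N x i hi => ?_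
    have := hg N e ((g N e).symm (h₀ e x)) i hi
    simpa using this
  · obtain ⟨e, he⟩ := mem_iUnion.1 (hgC N hx)
    obtain ⟨u, hu, hux⟩ := he
    refine mem_iUnion.2 ⟨e, u, hu, ?_⟩
    simp [hux]

theorem main_of_approx (G F : Set HilbertCube) (hG : IsGδ G) (hGd : Dense G)
    (hF : ∃ C : ℕ → Set HilbertCube, (∀ n, IsClosed (C n)) ∧ F = ⋃ n, C n) (n : ℕ)
    (approx : ∀ C : Set HilbertCube, IsClosed C → C ⊆ F →
      ∀ U : Fin n → Set HilbertCube, (∀ e, IsOpen (U e)) → (∀ e, Dense (U e)) →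
      ∀ (m : ℕ) (ε : ℝ), 0 < ε → ∃ g : Fin n → HilbertCube ≃ₜ HilbertCube,
        (∀ e q i, i < m → dist (g e q i) (q i) ≤ ε) ∧ C ⊆ ⋃ e, g e ⁻¹' U e) :
    IsGδ {h : Fin n → HilbertCube ≃ₜ HilbertCube | F ⊆ ⋃ i, (h i) '' G} ∧
    Dense {h : Fin n → HilbertCube ≃ₜ HilbertCube | F ⊆ ⋃ i, (h i) '' G} := by
  obtain ⟨C, hC, rfl⟩ := hF
  obtain ⟨f, hf, rfl⟩ := hG.eq_iInter_nat
  let V : ℕ → Set HilbertCube := fun j => ⋂ i ∈ Finset.range (j + 1), f i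
  have hV : ∀ j, IsOpen (V j) := fun j => isOpen_biInter_finset fun i _ => hf i
  have hVG : ∀ j, (⋂ n, f n) ⊆ V j := fun j x hx => by
    simp only [V, mem_iInter] at *
    intro i _; exact hx i
  have hVf : ∀ j, V j ⊆ f j := fun j x hx => by
    simp only [V, mem_iInter] at *
    exact hx j (by simp)
  have hVa : Antitone V := by
    intro a b hab x hx
    simp only [V, mem_iInter, Finset.mem_range] at *
    intro i hi; exact hx i (by omega)
  have heq : {h : Fin n → HilbertCube ≃ₜ HilbertCube | ⋃ m, C m ⊆ ⋃ i, (h i) '' ⋂ n, f n} =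
      ⋂ p : ℕ × ℕ, {h | C p.1 ⊆ ⋃ i, h i '' V p.2} := by
    ext h
    simp only [mem_ofPred_eq, mem_iInter]
    constructor
    · rintro hh ⟨m, j⟩ x hx
      obtain ⟨i, hi⟩ := mem_iUnion.1 (hh (mem_iUnion.2 ⟨m, hx⟩))
      exact mem_iUnion.2 ⟨i, image_mono (hVG j) hi⟩
    · intro hh x hx
      obtain ⟨m, hm⟩ := mem_iUnion.1 hx
      by_contra hcon
      have h1 : ∀ i, ∃ j, (h i).symm x ∉ V j := by
        intro i
        by_contra! h2
        exact hcon (mem_iUnion.2 ⟨i, (h i).symm x,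
          mem_iInter.2 fun j => hVf j (h2 j), by simp⟩)
      choose j hj using h1
      obtain ⟨i, u, hu, hux⟩ := mem_iUnion.1 (hh (m, Finset.univ.sup j) hm)
      refine hj i ?_
      rw [← hux]
      simpa using hVa (Finset.le_sup (Finset.mem_univ i)) hu
  rw [heq]
  have hop : ∀ p : ℕ × ℕ, IsOpen {h : Fin n → HilbertCube ≃ₜ HilbertCube |
      C p.1 ⊆ ⋃ i, h i '' V p.2} := fun p => isOpen_cover_by_images (hC _) (hV _)
  refine ⟨IsGδ.iInter fun p => (hop p).isGδ, ?_⟩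
  have := homeo_isCompletelyMetrizable (X := HilbertCube)
  exact dense_iInter_of_isOpen hop fun p => dense_cover_of_approx
    (approx (C p.1) (hC _) (subset_iUnion C _)) (hV _) (hGd.mono (hVG _))

theorem exists_continuous_eqOn_finite_convex {X E J : Type*} [TopologicalSpace X] [NormalSpace X]
    [ParacompactSpace X] [T2Space X] [AddCommGroup E] [Module ℝ E] [TopologicalSpace E]
    [ContinuousAdd E] [ContinuousSMul ℝ E] [Finite J] {K : Set E} (hK : Convex ℝ K)
    {e₀ : E} (he₀ : e₀ ∈ K) {D : J → Set X} (hD : ∀ j, IsClosed (D j))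
    (hdis : Pairwise fun i j => Disjoint (D i) (D j)) {f : J → E} (hf : ∀ j, f j ∈ K) :
    ∃ g : C(X, E), (∀ x, g x ∈ K) ∧ ∀ j, ∀ x ∈ D j, g x = f j := by
  let t : X → Set E := fun x => {e ∈ K | ∀ j, x ∈ D j → e = f j}
  have ht : ∀ x, Convex ℝ (t x) := by
    intro x a ha b hb s r hs hr hsr
    refine ⟨hK ha.1 hb.1 hs hr hsr, fun j hj => ?_⟩
    rw [ha.2 j hj, hb.2 j hj, ← add_smul, hsr, one_smul]
  have hloc : ∀ x, ∃ c, ∀ᶠ y in 𝓝 x, c ∈ t y := by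
    intro x
    by_cases hx : ∃ j, x ∈ D j
    · obtain ⟨j, hj⟩ := hx
      refine ⟨f j, ?_⟩
      have : ∀ᶠ y in 𝓝 x, ∀ i, i ≠ j → y ∉ D i := by
        rw [Filter.eventually_all]
        intro i
        by_cases hij : i = j
        · simp [hij]
        · filter_upwards [(hD i).isOpen_compl.mem_nhds
            (fun h => (hdis hij).le_bot ⟨h, hj⟩)] with y hy _ using hy
      filter_upwards [this] with y hy
      refine ⟨hf j, fun i hi => ?_⟩
      by_cases hij : i = j
      · rw [hij]
      · exact absurd hi (hy i hij)
    · refine ⟨e₀, ?_⟩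
      have : ∀ᶠ y in 𝓝 x, ∀ i, y ∉ D i := by
        rw [Filter.eventually_all]
        intro i
        exact (hD i).isOpen_compl.mem_nhds (fun h => hx ⟨i, h⟩)
      filter_upwards [this] with y hy
      exact ⟨he₀, fun i hi => absurd hi (hy i)⟩
  obtain ⟨g, hg⟩ := exists_continuous_forall_mem_convex_of_local_const ht hloc
  exact ⟨g, fun x => (hg x).1, fun j x hx => (hg x).2 j hx⟩

theorem exists_pairwise_disjoint_open_nhds {X J : Type*} [TopologicalSpace X] [CompactSpace X]
    [T2Space X] [Finite J] {D : J → Set X} (hD : ∀ j, IsClosed (D j))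
    (hdis : Pairwise fun i j => Disjoint (D i) (D j)) :
    ∃ N : J → Set X, (∀ j, IsOpen (N j)) ∧ (∀ j, D j ⊆ N j) ∧
      Pairwise fun i j => Disjoint (N i) (N j) := by
  obtain ⟨n, ⟨φ⟩⟩ := Finite.exists_equiv_fin J
  obtain ⟨g, -, hg⟩ := exists_continuous_eqOn_finite_convex (E := ℝ) convex_univ (mem_univ 0) hD hdis
    (f := fun j => ((φ j : ℕ) : ℝ)) (fun _ => mem_univ _)
  refine ⟨fun j => g ⁻¹' Metric.ball ((φ j : ℕ) : ℝ) (1 / 2),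
    fun j => Metric.isOpen_ball.preimage g.continuous, fun j x hx => by simp [hg j x hx], ?_⟩
  intro i j hij
  refine Disjoint.preimage _ (Metric.ball_disjoint_ball ?_)
  have h1 : (φ i : ℕ) ≠ φ j := fun h => hij (φ.injective (Fin.ext h))
  have h2 := Nat.pairwise_one_le_dist h1
  simp only [Nat.dist_eq] at h2
  rw [Real.dist_eq]
  linarith

/-- The families `O 0, …, O (n - 1)` are finite disjoint families of open sets inscribed in `V`,
and every point is covered by at least `r` of them. -/
def IsColored {X ι : Type*} [TopologicalSpace X] (V : ι → Set X) (n r : ℕ)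
    (O : ℕ → Set (Set X)) : Prop :=
  (∀ e, (O e).Finite ∧ (∀ W ∈ O e, IsOpen W ∧ ∃ i, W ⊆ V i) ∧ (O e).PairwiseDisjoint id) ∧
    ∀ x, ∃ T ⊆ Finset.range n, T.card = r ∧ ∀ e ∈ T, x ∈ ⋃₀ O e

theorem exists_isColored_one {X ι : Type*} [TopologicalSpace X] [NormalSpace X] [Fintype ι]
    {V : ι → Set X} (hV : ∀ i, IsOpen (V i)) (hcov : ⋃ i, V i = Set.univ) {k : ℕ}
    (hk : ∀ x, {i | x ∈ V i}.ncard ≤ k + 1) : ∃ O, IsColored V (k + 1) 1 O := by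
  classical
  obtain ⟨l, hl⟩ := PartitionOfUnity.exists_isSubordinate_of_locallyFinite isClosed_univ V hV
    (locallyFinite_of_finite V) hcov.ge
  have hsum : ∀ x, ∑ i, l i x = 1 := fun x => by
    rw [← finsum_eq_sum_of_fintype]; exact l.sum_eq_one (mem_univ x)
  have hlV : ∀ i x, 0 < l i x → x ∈ V i := fun i x h =>
    hl i (subset_tsupport _ (Function.mem_support.2 h.ne'))
  let W : Finset ι → Set X := fun σ => {x | ∀ a ∈ σ, 0 < l a x ∧ ∀ b, b ∉ σ → l b x < l a x}
  have hW : ∀ σ, IsOpen (W σ) := by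
    intro σ
    have : W σ = ⋂ a ∈ σ, ({x | 0 < l a x} ∩ ⋂ b ∈ (Finset.univ \ σ), {x | l b x < l a x}) := by
      ext x; simp [W]
    rw [this]
    exact isOpen_biInter_finset fun a _ => (isOpen_lt continuous_const (l a).continuous).inter
      (isOpen_biInter_finset fun b _ => isOpen_lt (l b).continuous (l a).continuous)
  refine ⟨fun e => W '' {σ | σ.card = e + 1}, fun e => ⟨(toFinite _).image _, ?_, ?_⟩, fun x => ?_⟩
  · rintro _ ⟨σ, hσ, rfl⟩
    refine ⟨hW σ, ?_⟩
    have hσ' : σ.card = e + 1 := hσ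
    obtain ⟨a, ha⟩ : σ.Nonempty := Finset.card_pos.1 (by omega)
    exact ⟨a, fun x hx => hlV a x (hx a ha).1⟩
  · rintro _ ⟨σ, hσ, rfl⟩ _ ⟨τ, hτ, rfl⟩ hne
    have hσ' : σ.card = e + 1 := hσ
    have hτ' : τ.card = e + 1 := hτ
    have hst : σ ≠ τ := fun h => hne (by rw [h])
    obtain ⟨a, ha, ha'⟩ : ∃ a ∈ σ, a ∉ τ := by
      by_contra! h
      exact hst (Finset.eq_of_subset_of_card_le h (by omega))
    obtain ⟨b, hb, hb'⟩ : ∃ a ∈ τ, a ∉ σ := by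
      by_contra! h
      exact hst (Finset.eq_of_subset_of_card_le h (by omega)).symm
    refine Set.disjoint_left.2 fun x hx hx' => ?_
    exact lt_asymm ((hx a ha).2 b hb') ((hx' b hb).2 a ha')
  · let σ : Finset ι := Finset.univ.filter fun a => 0 < l a x
    have hne : σ.Nonempty := by
      by_contra h
      rw [Finset.not_nonempty_iff_eq_empty, Finset.filter_eq_empty_iff] at h
      have : ∑ i, l i x ≤ 0 := Finset.sum_nonpos fun i hi => not_lt.1 (h hi)
      linarith [hsum x]
    have hcard : σ.card ≤ k + 1 := by
      rw [← Set.ncard_coe_finset]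
      refine (Set.ncard_le_ncard ?_ (toFinite _)).trans (hk x)
      intro a ha
      exact hlV a x (by simpa [σ] using ha)
    have := Finset.card_pos.2 hne
    refine ⟨{σ.card - 1}, by simpa using (by omega), by simp, fun e he => ?_⟩
    rw [Finset.mem_singleton] at he
    refine ⟨W σ, ⟨σ, by simp only [mem_ofPred_eq]; omega, rfl⟩, fun a ha => ?_⟩
    have ha' : 0 < l a x := by simpa [σ] using ha
    refine ⟨ha', fun b hb => ?_⟩
    have : l b x ≤ 0 := by simpa [σ] using hb
    linarith

theorem IsColored.succ {X ι : Type*} [TopologicalSpace X] [CompactSpace X] [T2Space X]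
    {V : ι → Set X} {n r : ℕ} {O : ℕ → Set (Set X)} (hO : IsColored V n (r + 1) O) :
    ∃ O', IsColored V (n + 1) (r + 2) O' := by
  classical
  let J := {S // S ∈ Finset.powersetCard (r + 1) (Finset.range n)}
  let D : J → Set X := fun S => {x | ∀ e ∈ Finset.range n \ S.1, x ∉ ⋃₀ O e}
  have : Finite J := Finset.finite_toSet _
  have hopen : ∀ e, IsOpen (⋃₀ O e) := fun e => isOpen_sUnion fun W hW => ((hO.1 e).2.1 W hW).1
  have hD : ∀ S, IsClosed (D S) := by
    intro S
    have : D S = ⋂ e ∈ Finset.range n \ S.1, (⋃₀ O e)ᶜ := by ext x; simp [D]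
    rw [this]
    exact isClosed_biInter fun e _ => (hopen e).isClosed_compl
  have hDT : ∀ (S : J) x, x ∈ D S → ∀ T ⊆ Finset.range n, T.card = r + 1 →
      (∀ e ∈ T, x ∈ ⋃₀ O e) → T = S.1 := by
    intro S x hx T hT hc hTx
    refine Finset.eq_of_subset_of_card_le (fun e he => ?_) ?_
    · by_contra h
      exact hx e (Finset.mem_sdiff.2 ⟨hT he, h⟩) (hTx e he)
    · rw [hc, (Finset.mem_powersetCard.1 S.2).2]
  have hdis : Pairwise fun S S' => Disjoint (D S) (D S') := by
    intro S S' hne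
    refine Set.disjoint_left.2 fun x hx hx' => hne ?_
    obtain ⟨T, hT, hc, hTx⟩ := hO.2 x
    exact Subtype.ext ((hDT S x hx T hT hc hTx).symm.trans (hDT S' x hx' T hT hc hTx))
  obtain ⟨N, hN, hDN, hNd⟩ := exists_pairwise_disjoint_open_nhds hD hdis
  have hne : ∀ S : J, ∃ e, e ∈ S.1 := fun S => Finset.card_pos.1 (by
    rw [(Finset.mem_powersetCard.1 S.2).2]; omega)
  choose c hc using hne
  let new : Set (Set X) := ⋃ S : J, (fun W => N S ∩ W) '' O (c S)
  refine ⟨Function.update O n new, fun e => ?_, fun x => ?_⟩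
  · by_cases he : e = n
    · subst he
      rw [Function.update_self]
      refine ⟨finite_iUnion fun S => (hO.1 _).1.image _, ?_, ?_⟩
      · intro W hW
        obtain ⟨S, W', hW', rfl⟩ := mem_iUnion.1 hW
        obtain ⟨h1, i, hi⟩ := (hO.1 _).2.1 W' hW'
        exact ⟨(hN S).inter h1, i, inter_subset_right.trans hi⟩
      · intro A hA B hB hAB
        obtain ⟨S, W, hW, rfl⟩ := mem_iUnion.1 hA
        obtain ⟨S', W', hW', rfl⟩ := mem_iUnion.1 hB
        by_cases hS : S = S'
        · subst hS
          have : W ≠ W' := fun h => hAB (by rw [h])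
          exact ((hO.1 _).2.2 hW hW' this).mono inter_subset_right inter_subset_right
        · exact (hNd hS).mono inter_subset_left inter_subset_left
    · rw [Function.update_of_ne he]
      exact hO.1 e
  · obtain ⟨T, hT, hTc, hTx⟩ := hO.2 x
    have hnT : n ∉ T := fun h => by simpa using hT h
    have hTx' : ∀ e ∈ T, x ∈ ⋃₀ Function.update O n new e := fun e he => by
      rw [Function.update_of_ne (fun h : e = n => hnT (h ▸ he))]
      exact hTx e he
    have hTn : T ⊆ Finset.range (n + 1) := hT.trans (Finset.range_mono (by omega))
    by_cases h : ∃ e ∈ Finset.range n \ T, x ∈ ⋃₀ O e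
    · obtain ⟨e, he, hex⟩ := h
      rw [Finset.mem_sdiff, Finset.mem_range] at he
      refine ⟨insert e T, Finset.insert_subset (by simpa using (by omega)) hTn, by
        rw [Finset.card_insert_of_notMem he.2, hTc], fun e' he' => ?_⟩
      rcases Finset.mem_insert.1 he' with rfl | h
      · rw [Function.update_of_ne (by omega)]; exact hex
      · exact hTx' _ h
    · push Not at h
      refine ⟨insert n T, Finset.insert_subset (by simp) hTn, by
        rw [Finset.card_insert_of_notMem hnT, hTc], fun e' he' => ?_⟩
      rcases Finset.mem_insert.1 he' with rfl | he
      · rw [Function.update_self]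
        let S : J := ⟨T, Finset.mem_powersetCard.2 ⟨hT, hTc⟩⟩
        obtain ⟨W, hW, hxW⟩ := hTx (c S) (hc S)
        exact ⟨N S ∩ W, mem_iUnion.2 ⟨S, W, hW, rfl⟩, hDN S h, hxW⟩
      · exact hTx' _ he

theorem IsColored.exists_closed {X ι : Type*} [TopologicalSpace X] [NormalSpace X]
    {V : ι → Set X} {n r : ℕ} {O : ℕ → Set (Set X)} (hO : IsColored V n r O) :
    ∃ P : ℕ → Set (Set X),
      (∀ e, (P e).Finite ∧ (∀ W ∈ P e, IsClosed W ∧ ∃ i, W ⊆ V i) ∧ (P e).PairwiseDisjoint id) ∧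
      ∀ x, ∃ T ⊆ Finset.range n, T.card = r ∧ ∀ e ∈ T, x ∈ ⋃₀ P e := by
  classical
  let J := {S // S ∈ Finset.powersetCard r (Finset.range n)}
  have : Finite J := Finset.finite_toSet _
  have hopen : ∀ e, IsOpen (⋃₀ O e) := fun e => isOpen_sUnion fun W hW => ((hO.1 e).2.1 W hW).1
  obtain ⟨K, hKcov, hKc, hKs⟩ := exists_iUnion_eq_closed_subset
    (u := fun S : J => ⋂ e ∈ S.1, ⋃₀ O e) (fun S => isOpen_biInter_finset fun e _ => hopen e)
    (fun x => toFinite _) (by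
      refine eq_univ_of_forall fun x => ?_
      obtain ⟨T, hT, hTc, hTx⟩ := hO.2 x
      exact mem_iUnion.2 ⟨⟨T, Finset.mem_powersetCard.2 ⟨hT, hTc⟩⟩, mem_iInter₂.2 hTx⟩)
  let L : ℕ → Set X := fun e => ⋃ S : {S : J // e ∈ S.1}, K S.1
  have hL : ∀ e, IsClosed (L e) := fun e => isClosed_iUnion_of_finite fun S => hKc _
  have hLO : ∀ e, L e ⊆ ⋃₀ O e := fun e => iUnion_subset fun S =>
    (hKs _).trans (biInter_subset_of_mem S.2)
  refine ⟨fun e => (fun W => L e ∩ W) '' O e, fun e => ⟨(hO.1 e).1.image _, ?_, ?_⟩, fun x => ?_⟩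
  · rintro _ ⟨W, hW, rfl⟩
    obtain ⟨h1, i, hi⟩ := (hO.1 e).2.1 W hW
    refine ⟨?_, i, inter_subset_right.trans hi⟩
    have : L e ∩ W = L e ∩ (⋃₀ (O e \ {W}))ᶜ := by
      ext x
      simp only [mem_inter_iff, mem_compl_iff, and_congr_right_iff]
      intro hx
      constructor
      · rintro hxW ⟨W', hW', hxW'⟩
        exact ((hO.1 e).2.2 hW hW'.1 (fun h => hW'.2 h.symm)).le_bot ⟨hxW, hxW'⟩
      · intro hn
        obtain ⟨W', hW', hxW'⟩ := hLO e hx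
        by_contra hxW
        exact hn ⟨W', ⟨hW', fun h => hxW (h ▸ hxW')⟩, hxW'⟩
    show IsClosed (L e ∩ W)
    rw [this]
    exact (hL e).inter (isOpen_sUnion fun W' hW' =>
      ((hO.1 e).2.1 W' hW'.1).1).isClosed_compl
  · rintro _ ⟨W, hW, rfl⟩ _ ⟨W', hW', rfl⟩ hne
    have : W ≠ W' := fun h => hne (by rw [h])
    exact ((hO.1 _).2.2 hW hW' this).mono inter_subset_right inter_subset_right
  · obtain ⟨S, hS⟩ := mem_iUnion.1 (hKcov.ge (mem_univ x))
    obtain ⟨h1, h2⟩ := Finset.mem_powersetCard.1 S.2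
    refine ⟨S.1, h1, h2, fun e he => ?_⟩
    have hx : x ∈ L e := mem_iUnion.2 ⟨⟨S, he⟩, hS⟩
    obtain ⟨W, hW, hxW⟩ := hLO e hx
    exact ⟨_, ⟨W, hW, rfl⟩, hx, hxW⟩

/-- A compact subset of a space of covering dimension at most `k` is covered, four times over,
by `k + 4` finite disjoint families of small closed sets. -/
theorem exists_closed_pieces {Y : Type*} [TopologicalSpace Y] [T2Space Y] {F C : Set Y}
    (hC : IsCompact C) (hCF : C ⊆ F) {k : ℕ} (hdim : CovDimLE F k)
    {U : Set (Set Y)} (hUf : U.Finite) (hUo : ∀ V ∈ U, IsOpen V) (hUc : ⋃₀ U = Set.univ) :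
    ∃ P : ℕ → Set (Set Y),
      (∀ e, (P e).Finite ∧ (∀ W ∈ P e, IsClosed W ∧ ∃ V ∈ U, W ⊆ V) ∧
        (P e).PairwiseDisjoint id) ∧
      ∀ x ∈ C, ∃ T ⊆ Finset.range (k + 4), T.card = 4 ∧ ∀ e ∈ T, x ∈ ⋃₀ P e := by
  obtain ⟨V, hVf, hVo, hVc, hVU, hVk⟩ := hdim ((fun W : Set Y => ((↑) : F → Y) ⁻¹' W) '' U)
    (hUf.image _) (by
      rintro _ ⟨W, hW, rfl⟩
      exact (hUo W hW).preimage continuous_subtype_val) (by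
      refine eq_univ_of_forall fun x => ?_
      obtain ⟨W, hW, hx⟩ := hUc.ge (mem_univ (x : Y))
      exact ⟨_, ⟨W, hW, rfl⟩, hx⟩)
  have := hVf.fintype
  have : CompactSpace C := isCompact_iff_compactSpace.1 hC
  let ic : C → F := inclusion hCF
  have hic : Continuous ic := continuous_inclusion hCF
  let V' : V → Set C := fun W => ic ⁻¹' W.1
  obtain ⟨O, hO⟩ := exists_isColored_one (V := V') (k := k) (fun W => (hVo W.1 W.2).preimage hic)
    (by
      refine eq_univ_of_forall fun x => ?_
      obtain ⟨W, hW, hx⟩ := hVc.ge (mem_univ (ic x))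
      exact mem_iUnion.2 ⟨⟨W, hW⟩, hx⟩)
    (fun x => by
      refine le_trans ?_ (hVk (ic x))
      rw [← Set.ncard_image_of_injective _ Subtype.val_injective]
      refine Set.ncard_le_ncard ?_ (hVf.subset fun W hW => hW.1)
      rintro _ ⟨W, hW, rfl⟩
      exact ⟨W.2, hW⟩)
  obtain ⟨O₂, hO₂⟩ := hO.succ
  obtain ⟨O₃, hO₃⟩ := hO₂.succ
  obtain ⟨O₄, hO₄⟩ := hO₃.succ
  obtain ⟨P, hP, hPx⟩ := hO₄.exists_closed
  refine ⟨fun e => (fun W => ((↑) : C → Y) '' W) '' P e,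
    fun e => ⟨(hP e).1.image _, ?_, ?_⟩, fun x hx => ?_⟩
  · rintro _ ⟨W, hW, rfl⟩
    obtain ⟨h1, i, hi⟩ := (hP e).2.1 W hW
    refine ⟨hC.isClosed.isClosedEmbedding_subtypeVal.isClosedMap _ h1, ?_⟩
    obtain ⟨_, ⟨W', hW', rfl⟩, hs⟩ := hVU i.1 i.2
    refine ⟨W', hW', ?_⟩
    rintro _ ⟨x, hx, rfl⟩
    exact hs (hi hx)
  · rintro _ ⟨W, hW, rfl⟩ _ ⟨W', hW', rfl⟩ hne
    have h : W ≠ W' := fun h => hne (by rw [h])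
    exact (disjoint_image_iff Subtype.val_injective).2 ((hP e).2.2 hW hW' h)
  · obtain ⟨T, hT, hTc, hTx⟩ := hPx ⟨x, hx⟩
    refine ⟨T, hT, hTc, fun e he => ?_⟩
    obtain ⟨W, hW, hxW⟩ := hTx e he
    exact ⟨_, ⟨W, hW, rfl⟩, ⟨x, hx⟩, hxW, rfl⟩

/-- `κ` is displaced from itself by a flow supported in `O`. -/
def IsDisplaceable {Z : Type*} [TopologicalSpace Z] (κ O : Set Z) : Prop :=
  ∃ σ : ℝ → Z → Z, (Continuous fun p : ℝ × Z => σ p.1 p.2) ∧ (∀ p, σ 0 p = p) ∧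
    (∀ s t p, σ (s + t) p = σ s (σ t p)) ∧ (∀ t, ∀ p ∉ O, σ t p = p) ∧
    ∃ L, ∀ t, L < t → ∀ p ∈ κ, σ t p ∉ κ

theorem IsDisplaceable.mono {Z : Type*} [TopologicalSpace Z] {κ κ' O O' : Set Z}
    (h : IsDisplaceable κ O) (hκ : κ' ⊆ κ) (hO : O ⊆ O') : IsDisplaceable κ' O' := by
  obtain ⟨σ, h1, h2, h3, h4, L, hL⟩ := h
  exact ⟨σ, h1, h2, h3, fun t p hp => h4 t p fun h => hp (hO h), L,
    fun t ht p hp h => hL t ht p (hκ hp) (hκ h)⟩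

theorem IsDisplaceable.preimage {Z Z' : Type*} [TopologicalSpace Z] [TopologicalSpace Z']
    {κ O : Set Z'} (h : IsDisplaceable κ O) (χ : Z ≃ₜ Z') :
    IsDisplaceable (χ ⁻¹' κ) (χ ⁻¹' O) := by
  obtain ⟨σ, h1, h2, h3, h4, L, hL⟩ := h
  refine ⟨fun t p => χ.symm (σ t (χ p)), ?_, fun p => by simp [h2], fun s t p => by simp [h3],
    fun t p hp => by simp [h4 t _ hp], L, fun t ht p hp h => hL t ht (χ p) hp (by simpa using h)⟩
  exact χ.symm.continuous.comp
    (h1.comp (continuous_fst.prodMk (χ.continuous.comp continuous_snd)))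

theorem IsDisplaceable.prod {A B : Type*} [TopologicalSpace A] [TopologicalSpace B]
    [NormalSpace B] {κ O : Set A} (h : IsDisplaceable κ O) {κ' O' : Set B} (hκ : IsClosed κ')
    (hO : IsOpen O') (hκO : κ' ⊆ O') : IsDisplaceable (κ ×ˢ κ') (O ×ˢ O') := by
  obtain ⟨σ, h1, h2, h3, h4, L, hL⟩ := h
  obtain ⟨θ, hθ0, hθ1, -⟩ := exists_continuous_zero_one_of_isClosed hO.isClosed_compl hκ
    (disjoint_compl_left_iff_subset.2 hκO)
  refine ⟨fun t p => (σ (t * θ p.2) p.1, p.2), ?_, fun p => by simp [h2], fun s t p => by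
    simp [add_mul, h3], fun t p hp => ?_, L, fun t ht p hp h => ?_⟩
  · have : Continuous fun p : ℝ × A × B => (p.1 * θ p.2.2, p.2.1) := by fun_prop
    exact (h1.comp this).prodMk (by fun_prop)
  · rw [mem_prod, not_and_or] at hp
    rcases hp with hp | hp
    · simp [h4 _ _ hp]
    · have : θ p.2 = 0 := hθ0 hp
      simp [this, h2]
  · have h5 : θ p.2 = 1 := hθ1 hp.2
    simp only [h5, mul_one] at h
    exact hL t ht p.1 hp.1 h.1

theorem isDisplaceable_Icc {c' c d d' : ℝ} (h0 : 0 ≤ c') (h1 : c' < c) (h2 : c ≤ d)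
    (h3 : d < d') (h4 : d' ≤ 1) :
    IsDisplaceable {z : Icc (0 : ℝ) 1 | (z : ℝ) ∈ Icc c d} {z | (z : ℝ) ∈ Ioo c' d'} := by
  have hl : 0 < d' - c' := by linarith
  let cl : ℝ → ℝ := fun z => max 0 (min 1 ((z - c') / (d' - c')))
  let f : ℝ → ℝ → ℝ := fun t z => z + (d' - c') * (cl z ^ Real.exp t - cl z)
  have hf1 : ∀ t z, z ∈ Icc c' d' → cl z ∈ Icc 0 1 ∧ z = c' + (d' - c') * cl z ∧
      f t z = c' + (d' - c') * cl z ^ Real.exp t ∧ f t z ∈ Icc c' d' ∧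
      cl (f t z) = cl z ^ Real.exp t := by
    intro t z hz
    have hu0 : 0 ≤ (z - c') / (d' - c') := div_nonneg (by linarith [hz.1]) hl.le
    have hu1 : (z - c') / (d' - c') ≤ 1 := (div_le_one hl).2 (by linarith [hz.2])
    have hcl : cl z = (z - c') / (d' - c') := by simp [cl, hu0, hu1]
    have hz' : z = c' + (d' - c') * cl z := by rw [hcl]; field_simp; ring
    have hf : f t z = c' + (d' - c') * cl z ^ Real.exp t := by
      simp only [f]; nth_rewrite 1 [hz']; ring
    have hcm : cl z ∈ Icc (0 : ℝ) 1 := by rw [hcl]; exact ⟨hu0, hu1⟩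
    have hp0 : 0 ≤ cl z ^ Real.exp t := Real.rpow_nonneg hcm.1 _
    have hp1 : cl z ^ Real.exp t ≤ 1 := Real.rpow_le_one hcm.1 hcm.2 (Real.exp_pos t).le
    refine ⟨hcm, hz', hf, ?_, ?_⟩
    · rw [hf]; constructor <;> nlinarith
    · have : (f t z - c') / (d' - c') = cl z ^ Real.exp t := by rw [hf]; field_simp; ring
      simp only [cl, this] at *
      simp only [hp0, hp1, min_eq_right, max_eq_right]
  have hf2 : ∀ t z, z ∉ Ioo c' d' → f t z = z := by
    intro t z hz
    rw [mem_Ioo, not_and_or, not_lt, not_lt] at hz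
    have : cl z = 0 ∨ cl z = 1 := by
      rcases hz with h | h
      · left
        have : (z - c') / (d' - c') ≤ 0 := div_nonpos_of_nonpos_of_nonneg (by linarith) hl.le
        simp [cl, this]
      · right
        have : 1 ≤ (z - c') / (d' - c') := (one_le_div hl).2 (by linarith)
        simp [cl, this]
    rcases this with h | h <;> simp [f, h, (Real.exp_pos t).ne']
  have hfc : Continuous fun p : ℝ × ℝ => f p.1 p.2 := by
    have hc : Continuous fun p : ℝ × ℝ => cl p.2 := by
      simp only [cl]; fun_prop
    have hp : Continuous fun p : ℝ × ℝ => cl p.2 ^ Real.exp p.1 :=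
      hc.rpow (by fun_prop) fun p => Or.inr (Real.exp_pos _)
    simp only [f]
    fun_prop
  have hm : ∀ t z, z ∈ Icc (0 : ℝ) 1 → f t z ∈ Icc (0 : ℝ) 1 := by
    intro t z hz
    by_cases h : z ∈ Ioo c' d'
    · have := (hf1 t z ⟨h.1.le, h.2.le⟩).2.2.2.1
      exact ⟨h0.trans this.1, this.2.trans h4⟩
    · rw [hf2 t z h]; exact hz
  refine ⟨fun t z => ⟨f t z, hm t z z.2⟩, ?_, ?_, ?_, ?_, ?_⟩
  · refine Continuous.subtype_mk ?_ _
    exact hfc.comp (continuous_fst.prodMk (continuous_subtype_val.comp continuous_snd))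
  · intro p; ext; simp [f]
  · intro s t p
    ext
    show f (s + t) p = f s (f t p)
    by_cases h : (p : ℝ) ∈ Ioo c' d'
    · obtain ⟨a1, a2, a3, a4, a5⟩ := hf1 t p ⟨h.1.le, h.2.le⟩
      rw [(hf1 (s + t) p ⟨h.1.le, h.2.le⟩).2.2.1, (hf1 s _ a4).2.2.1, a5, ← Real.rpow_mul a1.1,
        add_comm s t, Real.exp_add]
    · rw [hf2 _ _ h, hf2 _ _ h, hf2 _ _ h]
  · intro t p hp
    ext
    exact hf2 t p hp
  · have hb : (0:ℝ) < cl c := by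
      have := (hf1 0 c ⟨h1.le, by linarith⟩).2.1
      by_contra hcon
      nlinarith
    have hd1 : cl d < 1 := by
      have := (hf1 0 d ⟨by linarith, h3.le⟩).2.1
      by_contra hcon
      nlinarith
    have hcld := (hf1 0 d ⟨by linarith, h3.le⟩).1
    have ht : Filter.Tendsto (fun t : ℝ => cl d ^ Real.exp t) Filter.atTop (𝓝 0) :=
      (tendsto_rpow_atTop_of_base_lt_one (cl d) (by linarith [hcld.1]) hd1).comp
        Real.tendsto_exp_atTop
    obtain ⟨L, hL⟩ := Filter.eventually_atTop.1 (ht.eventually (gt_mem_nhds hb))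
    refine ⟨L, fun t htL p hp hp' => ?_⟩
    have hpI : (p : ℝ) ∈ Icc c' d' := ⟨by linarith [hp.1], by linarith [hp.2]⟩
    obtain ⟨a1, a2, a3, a4, a5⟩ := hf1 t p hpI
    have hpd : cl p ≤ cl d := by
      have := (hf1 0 d ⟨by linarith, h3.le⟩).2.1
      have := hp.2
      by_contra hcon
      nlinarith
    have hcp : cl c ≤ cl (f t p) := by
      have e1 := (hf1 0 c ⟨h1.le, by linarith⟩).2.1
      have e2 := (hf1 0 _ a4).2.1
      have e3 : c ≤ f t p := hp'.1
      by_contra hcon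
      nlinarith
    have h6 := Real.rpow_le_rpow a1.1 hpd (Real.exp_pos t).le
    linarith [hL t htL.le]

/-- The continuous strictly increasing functions on `[0,1]` that fix both endpoints. -/
def increasingFns : Set C(Icc (0 : ℝ) 1, ℝ) := {f | StrictMono f ∧ f 0 = 0 ∧ f 1 = 1}

theorem convex_increasingFns : Convex ℝ increasingFns := by
  rintro f ⟨hf, hf0, hf1⟩ g ⟨hg, hg0, hg1⟩ s t hs ht hst
  refine ⟨fun x y hxy => ?_, by simp [hf0, hg0], by simpa [hf1, hg1] using hst⟩
  have h1 := hf hxy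
  have h2 := hg hxy
  simp only [ContinuousMap.add_apply, ContinuousMap.smul_apply, smul_eq_mul]
  rcases hs.lt_or_eq with h | h
  · nlinarith
  · have : t = 1 := by linarith
    subst h; subst this; linarith

theorem mem_Icc_of_mem_increasingFns {f : C(Icc (0 : ℝ) 1, ℝ)} (hf : f ∈ increasingFns)
    (x : Icc (0 : ℝ) 1) : f x ∈ Icc (0 : ℝ) 1 :=
  ⟨hf.2.1.symm.trans_le (hf.1.monotone x.2.1), (hf.1.monotone x.2.2).trans_eq hf.2.2⟩

/-- The inclusion of the unit interval in the real line. -/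
def coeUnit : C(Icc (0 : ℝ) 1, ℝ) := ⟨Subtype.val, continuous_subtype_val⟩

theorem coeUnit_mem : coeUnit ∈ increasingFns := ⟨fun _ _ h => h, rfl, rfl⟩

theorem exists_mem_increasingFns {a b : Icc (0 : ℝ) 1} {α β : ℝ} (ha : 0 < (a : ℝ))
    (hab : (a : ℝ) < b) (hb : (b : ℝ) < 1) (hα : 0 < α) (hαβ : α < β) (hβ : β < 1) :
    ∃ f ∈ increasingFns, f a = α ∧ f b = β ∧
      ∀ x : Icc (0 : ℝ) 1, |f x - x| ≤ max |α - a| |β - b| := by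
  obtain ⟨a, ha1⟩ := a
  obtain ⟨b, hb1⟩ := b
  change 0 < a at ha
  change a < b at hab
  change b < 1 at hb
  obtain ⟨A, hA, hA0⟩ : ∃ A, A * a = α ∧ 0 < A :=
    ⟨α / a, by field_simp, by positivity⟩
  obtain ⟨B, hB, hB0⟩ : ∃ B, B * (b - a) = β - α ∧ 0 < B :=
    ⟨(β - α) / (b - a), by field_simp [(sub_pos.2 hab).ne'],
      div_pos (by linarith) (by linarith)⟩
  obtain ⟨D, hD, hD0⟩ : ∃ D, D * (1 - b) = 1 - β ∧ 0 < D :=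
    ⟨(1 - β) / (1 - b), by field_simp [(sub_pos.2 hb).ne'],
      div_pos (by linarith) (by linarith)⟩
  let g : ℝ → ℝ := fun x => A * min x a + B * (max a (min x b) - a) + D * (max x b - b)
  have g1 : ∀ x ≤ a, g x = A * x := fun x hx => by
    simp [g, hx, hx.trans hab.le]
  have g2 : ∀ x, a ≤ x → x ≤ b → g x = α + B * (x - a) := fun x h1 h2 => by
    simp [g, h1, h2, hA]
  have g3 : ∀ x, b ≤ x → g x = β + D * (x - b) := fun x h => by
    simp [g, h, hab.le, hab.le.trans h, hA, hB]
  have aff : ∀ {p q c d x M : ℝ}, p * c + q ≤ M → p * d + q ≤ M → c ≤ x → x ≤ d →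
      p * x + q ≤ M := fun {p q c d x M} h1 h2 h3 h4 => by
    rcases le_total 0 p with h | h <;> nlinarith
  have hmono : StrictMono g := by
    intro x y hxy
    have m1 : A * min x a ≤ A * min y a :=
      mul_le_mul_of_nonneg_left (min_le_min_right a hxy.le) hA0.le
    have m2 : B * (max a (min x b) - a) ≤ B * (max a (min y b) - a) :=
      mul_le_mul_of_nonneg_left
        (sub_le_sub_right (max_le_max_left a (min_le_min_right b hxy.le)) a) hB0.le
    have m3 : D * (max x b - b) ≤ D * (max y b - b) :=
      mul_le_mul_of_nonneg_left (sub_le_sub_right (max_le_max_right b hxy.le) b) hD0.le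
    simp only [g]
    rcases lt_or_ge x a with h | h
    · have : A * min x a < A * min y a :=
        mul_lt_mul_of_pos_left (by rw [min_eq_left h.le]; exact lt_min hxy h) hA0
      linarith
    · rcases lt_or_ge x b with h' | h'
      · have : B * (max a (min x b) - a) < B * (max a (min y b) - a) := by
          refine mul_lt_mul_of_pos_left (sub_lt_sub_right ?_ a) hB0
          rw [min_eq_left h'.le, max_eq_right h]
          exact lt_max_of_lt_right (lt_min hxy h')
        linarith
      · have : D * (max x b - b) < D * (max y b - b) := by
          refine mul_lt_mul_of_pos_left (sub_lt_sub_right ?_ b) hD0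
          rw [max_eq_left h']
          exact lt_max_of_lt_left hxy
        linarith
  refine ⟨⟨fun x => g x, by simp only [g]; fun_prop⟩, ⟨fun x y h => hmono h, ?_, ?_⟩, ?_, ?_, ?_⟩
  · simp [g1 0 ha.le]
  · simp [g3 1 hb.le, hD]
  · simp [g1 a le_rfl, hA]
  · simp [g3 b le_rfl]
  · rintro ⟨x, hx0, hx1⟩
    simp only [ContinuousMap.coe_mk]
    have M1 := (abs_le.1 (le_max_left |α - a| |β - b|))
    have M2 := (abs_le.1 (le_max_right |α - a| |β - b|))
    set M := max |α - a| |β - b|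
    have M0 : 0 ≤ M := (abs_nonneg _).trans (le_max_left |α - a| |β - b|)
    rw [abs_le]
    rcases le_total x a with h | h
    · rw [g1 x h]
      have e1 := aff (p := A - 1) (q := 0) (M := M) (c := 0) (d := a) (by linarith)
        (by linarith) hx0 h
      have e2 := aff (p := 1 - A) (q := 0) (M := M) (c := 0) (d := a) (by linarith)
        (by linarith) hx0 h
      constructor <;> linarith
    · rcases le_total x b with h' | h'
      · rw [g2 x h h']
        have e1 := aff (p := B - 1) (q := α - B * a) (M := M) (by linarith)
          (by linarith) h h'
        have e2 := aff (p := 1 - B) (q := B * a - α) (M := M) (by linarith)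
          (by linarith) h h'
        constructor <;> linarith
      · rw [g3 x h']
        have e1 := aff (p := D - 1) (q := β - D * b) (M := M) (by linarith)
          (by linarith) h' hx1
        have e2 := aff (p := 1 - D) (q := D * b - β) (M := M) (by linarith)
          (by linarith) h' hx1
        constructor <;> linarith

/-- A homeomorphism of the square supported near a corner, which slides points along the
boundary. -/
theorem exists_corner_homeomorph {β : ℝ} (hβ0 : 0 < β) (hβ1 : β ≤ 1) :
    ∃ T : (Icc (0 : ℝ) 1 × Icc (0 : ℝ) 1) ≃ₜ (Icc (0 : ℝ) 1 × Icc (0 : ℝ) 1),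
      (∀ p, β ≤ (p.1 : ℝ) ∨ β ≤ (p.2 : ℝ) → T p = p) ∧
      (∀ p, |((T p).1 : ℝ) - p.1| ≤ β) ∧
      (∀ p, (p.2 : ℝ) = 0 → ((T p).2 : ℝ) = 0 ∧
        ((T p).1 : ℝ) = p.1 + max 0 (β - p.1) / 2) ∧
      (∀ p, (p.1 : ℝ) ≤ β / 4 → (p.2 : ℝ) ≤ β / 4 →
        β / 8 ≤ ((T p).1 : ℝ) ∧ ((T p).1 : ℝ) ≤ 3 * β / 4 ∧ ((T p).2 : ℝ) ≤ β / 4) := by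
  let m : ℝ → ℝ := fun s => max 0 (β - s)
  let F : ℝ → ℝ → ℝ := fun s h => max h (min ((h + m s) / 2) ((3 * h + m s) / 2))
  let G : ℝ → ℝ → ℝ := fun s k => min k (max (2 * k - m s) ((2 * k - m s) / 3))
  have hm0 : ∀ s, 0 ≤ m s := fun s => le_max_left _ _
  have hm1 : ∀ s, s ≤ 1 → m s ≤ 1 - s := fun s hs => max_le (by linarith) (by linarith)
  have hmβ : ∀ s, 0 ≤ s → m s ≤ β := fun s hs => max_le hβ0.le (by linarith)
  have hFG : ∀ s h, F s (G s h) = h := by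
    intro s h
    have := hm0 s
    simp only [F, G]
    rcases le_total (2 * h - m s) ((2 * h - m s) / 3) with h1 | h1 <;>
    [rw [max_eq_right h1]; rw [max_eq_left h1]] <;>
    [rcases le_total h ((2 * h - m s) / 3) with h2 | h2;
      rcases le_total h (2 * h - m s) with h2 | h2] <;>
    first
    | rw [min_eq_left h2]
    | rw [min_eq_right h2]
    all_goals
      first
      | (rw [max_eq_left]; rw [min_le_iff]; first | (left; linarith) | (right; linarith))
      | (rw [max_eq_right, min_eq_left] <;> first | linarith | (rw [le_min_iff]; constructor <;> linarith))
      | (rw [max_eq_right, min_eq_right] <;> first | linarith | (rw [le_min_iff]; constructor <;> linarith))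
  have hGF : ∀ s h, G s (F s h) = h := by
    intro s h
    have := hm0 s
    simp only [F, G]
    rcases le_total ((h + m s) / 2) ((3 * h + m s) / 2) with h1 | h1 <;>
    [rw [min_eq_left h1]; rw [min_eq_right h1]] <;>
    [rcases le_total h ((h + m s) / 2) with h2 | h2;
      rcases le_total h ((3 * h + m s) / 2) with h2 | h2] <;>
    first
    | rw [max_eq_right h2]
    | rw [max_eq_left h2]
    all_goals
      first
      | (rw [min_eq_left]; rw [le_max_iff]; first | (left; linarith) | (right; linarith))
      | (rw [min_eq_right, max_eq_left] <;> first | linarith | (rw [max_le_iff]; constructor <;> linarith))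
      | (rw [min_eq_right, max_eq_right] <;> first | linarith | (rw [max_le_iff]; constructor <;> linarith))
  have hFu : ∀ s h, s ≤ 1 → h ≤ 1 - s → F s h ≤ 1 - s := by
    intro s h hs hh
    have := hm1 s hs
    exact max_le hh (min_le_of_left_le (by linarith))
  have hFl : ∀ s h, h ≤ F s h := fun s h => le_max_left _ _
  have hFd : ∀ s h, F s h ≤ max h 0 + m s := by
    intro s h
    have := hm0 s
    have h1 := le_max_left h 0
    have h2 := le_max_right h 0
    exact max_le (by linarith) (min_le_of_left_le (by linarith))
  have hGu : ∀ s h, G s h ≤ h := fun s h => min_le_left _ _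
  have hGl : ∀ s h, s ≤ 1 → -(1 - s) ≤ h → -(1 - s) ≤ G s h := by
    intro s h hs hh
    have := hm1 s hs
    exact le_min hh (le_max_of_le_right (by linarith))
  have hms : ∀ x w : ℝ, min x w + max (x - w) 0 = x ∧ min x w + max (-(x - w)) 0 = w := by
    intro x w
    rcases le_total x w with h | h
    · rw [min_eq_left h, max_eq_right (by linarith), max_eq_left (by linarith)]
      constructor <;> linarith
    · rw [min_eq_right h, max_eq_left (by linarith), max_eq_right (by linarith)]
      constructor <;> linarith
  have hsm : ∀ s h : ℝ, min (s + max h 0) (s + max (-h) 0) = s ∧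
      (s + max h 0) - (s + max (-h) 0) = h := by
    intro s h
    rcases le_total h 0 with h' | h'
    · rw [max_eq_right h', max_eq_left (by linarith), min_eq_left (by linarith)]
      constructor <;> linarith
    · rw [max_eq_left h', max_eq_right (by linarith), min_eq_right (by linarith)]
      constructor <;> linarith
  have hr : ∀ s h : ℝ, 0 ≤ s → h ≤ 1 - s → -(1 - s) ≤ h → s + max h 0 ∈ Icc (0 : ℝ) 1 ∧
      s + max (-h) 0 ∈ Icc (0 : ℝ) 1 := by
    intro s h h1 h2 h3
    have e1 : max h 0 ≤ 1 - s := max_le h2 (by linarith)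
    have e2 : max (-h) 0 ≤ 1 - s := max_le (by linarith) (by linarith)
    exact ⟨⟨add_nonneg h1 (le_max_right _ _), by linarith⟩,
      ⟨add_nonneg h1 (le_max_right _ _), by linarith⟩⟩
  have hb : ∀ x w : Icc (0 : ℝ) 1, 0 ≤ min (x : ℝ) w ∧ (x : ℝ) - w ≤ 1 - min (x : ℝ) w ∧
      -(1 - min (x : ℝ) w) ≤ (x : ℝ) - w ∧ min (x : ℝ) w ≤ 1 := by
    rintro ⟨x, hx0, hx1⟩ ⟨w, hw0, hw1⟩
    refine ⟨le_min hx0 hw0, ?_, ?_, min_le_of_left_le hx1⟩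
    · have := min_le_right x w
      simp only; linarith
    · have := min_le_left x w
      simp only; linarith
  have hF1 := fun x w : Icc (0 : ℝ) 1 => hr (min (x : ℝ) w) (F (min (x : ℝ) w) (x - w)) (hb x w).1
    (hFu _ _ (hb x w).2.2.2 (hb x w).2.1) ((hb x w).2.2.1.trans (hFl _ _))
  have hG1 := fun x w : Icc (0 : ℝ) 1 => hr (min (x : ℝ) w) (G (min (x : ℝ) w) (x - w)) (hb x w).1
    ((hGu _ _).trans (hb x w).2.1) (hGl _ _ (hb x w).2.2.2 (hb x w).2.2.1)
  let T : (Icc (0 : ℝ) 1 × Icc (0 : ℝ) 1) ≃ₜ (Icc (0 : ℝ) 1 × Icc (0 : ℝ) 1) :=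
    { toFun := fun p => (⟨_, (hF1 p.1 p.2).1⟩, ⟨_, (hF1 p.1 p.2).2⟩)
      invFun := fun p => (⟨_, (hG1 p.1 p.2).1⟩, ⟨_, (hG1 p.1 p.2).2⟩)
      left_inv := by
        rintro ⟨x, w⟩
        simp only [(hsm _ _).1, (hsm _ _).2, hGF, (hms _ _).1, (hms _ _).2]
      right_inv := by
        rintro ⟨x, w⟩
        simp only [(hsm _ _).1, (hsm _ _).2, hFG, (hms _ _).1, (hms _ _).2]
      continuous_toFun := by simp only [F, m]; fun_prop
      continuous_invFun := by simp only [G, m]; fun_prop }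
  have hT1 : ∀ p, ((T p).1 : ℝ) = min (p.1 : ℝ) p.2 + max (F (min (p.1 : ℝ) p.2) (p.1 - p.2)) 0 :=
    fun p => rfl
  have hT2 : ∀ p, ((T p).2 : ℝ) =
      min (p.1 : ℝ) p.2 + max (-F (min (p.1 : ℝ) p.2) (p.1 - p.2)) 0 := fun p => rfl
  have hFid : ∀ x w : ℝ, β ≤ x ∨ β ≤ w → F (min x w) (x - w) = x - w := by
    intro x w h
    refine max_eq_left (min_le_iff.2 ?_)
    have : m (min x w) ≤ |x - w| := by
      refine max_le (abs_nonneg _) ?_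
      have a1 := le_abs_self (x - w)
      have a2 := neg_abs_le (x - w)
      have a3 : max x w = min x w + |x - w| := by
        rcases le_total x w with h' | h'
        · rw [max_eq_right h', min_eq_left h', abs_of_nonpos (by linarith)]; ring
        · rw [max_eq_left h', min_eq_right h', abs_of_nonneg (by linarith)]; ring
      have a4 : β ≤ max x w := le_max_iff.2 h
      linarith
    rcases le_abs.1 this with h | h
    · left; linarith
    · right; linarith
  refine ⟨T, fun p hp => ?_, fun p => ?_, fun p hp => ?_, fun p hx hw => ?_⟩
  · ext
    · rw [hT1, hFid _ _ hp, (hms _ _).1]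
    · rw [hT2, hFid _ _ hp, (hms _ _).2]
  · have e1 : (p.1 : ℝ) = min (p.1 : ℝ) p.2 + max ((p.1 : ℝ) - p.2) 0 := (hms _ _).1.symm
    rw [hT1]
    have e2 := hFd (min (p.1 : ℝ) p.2) (p.1 - p.2)
    have e3 := hFl (min (p.1 : ℝ) p.2) (p.1 - p.2)
    have e4 := hmβ _ (hb p.1 p.2).1
    have e5 : max ((p.1 : ℝ) - p.2) 0 ≤ max (F (min (p.1 : ℝ) p.2) (p.1 - p.2)) 0 :=
      max_le_max_right 0 e3
    have e6 : max (F (min (p.1 : ℝ) p.2) (p.1 - p.2)) 0 ≤ max ((p.1 : ℝ) - p.2) 0 + β :=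
      max_le (by linarith) (by linarith [le_max_right ((p.1 : ℝ) - p.2) 0])
    rw [abs_le]
    constructor <;> linarith
  · have h0 : min (p.1 : ℝ) p.2 = 0 := by rw [hp]; exact min_eq_right p.1.2.1
    have hx := p.1.2.1
    have : F 0 p.1 = p.1 + max 0 (β - p.1) / 2 := by
      simp only [F, m, sub_zero, max_eq_right hβ0.le]
      rw [min_eq_left (by linarith)]
      rcases le_total β p.1 with h | h
      · rw [max_eq_left (by linarith), max_eq_left (by linarith)]; ring
      · rw [max_eq_right (by linarith), max_eq_right (by linarith)]; ring
    have h2 : 0 ≤ max 0 (β - p.1) := le_max_left _ _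
    rw [hT1, hT2, h0, hp, sub_zero, this]
    constructor
    · rw [max_eq_right (by linarith)]; ring
    · rw [max_eq_left (by linarith)]; ring
  · have hx0 := p.1.2.1
    have hw0 := p.2.2.1
    have hs : min (p.1 : ℝ) p.2 ≤ β / 4 := min_le_of_left_le hx
    have hmm : m (min (p.1 : ℝ) p.2) = β - min (p.1 : ℝ) p.2 := max_eq_right (by linarith)
    have hFv : F (min (p.1 : ℝ) p.2) (p.1 - p.2) = 
        min ((p.1 - p.2 + (β - min (p.1 : ℝ) p.2)) / 2) 
          ((3 * (p.1 - p.2) + (β - min (p.1 : ℝ) p.2)) / 2) := by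
      simp only [F, hmm]
      refine max_eq_right (le_min ?_ ?_) <;> linarith
    rw [hT1, hT2, hFv]
    rcases le_total (p.1 : ℝ) p.2 with h | h
    · rw [min_eq_left h, min_eq_right (by linarith), max_eq_left (by linarith),
        max_eq_right (by linarith)]
      refine ⟨?_, ?_, ?_⟩ <;> linarith
    · rw [min_eq_right h, min_eq_left (by linarith), max_eq_left (by linarith),
        max_eq_right (by linarith)]
      refine ⟨?_, ?_, ?_⟩ <;> linarith

theorem exists_homeomorph_of_mem_increasingFns {f : C(Icc (0 : ℝ) 1, ℝ)} (hf : f ∈ increasingFns) :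
    ∃ φ : Icc (0 : ℝ) 1 ≃ₜ Icc (0 : ℝ) 1, ∀ x, (φ x : ℝ) = f x := by
  let g : Icc (0 : ℝ) 1 → Icc (0 : ℝ) 1 := fun x => ⟨f x, mem_Icc_of_mem_increasingFns hf x⟩
  have hg : IsHomeomorph g := by
    rw [isHomeomorph_iff_continuous_bijective]
    refine ⟨f.continuous.subtype_mk _, fun x y h => hf.1.injective (congrArg Subtype.val h),
      fun y => ?_⟩
    obtain ⟨x, hx⟩ := intermediate_value_univ (0 : Icc (0 : ℝ) 1) 1 f.continuous
      (show (y : ℝ) ∈ Icc _ _ from ⟨hf.2.1.trans_le y.2.1, y.2.2.trans_eq hf.2.2.symm⟩)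
    exact ⟨x, Subtype.ext hx⟩
  exact ⟨hg.homeomorph g, fun x => rfl⟩

theorem isDisplaceable_corner {u u' v v' : ℝ} (hu : 0 < u) (huu : u < u') (hu' : u' < 1)
    (hv : 0 < v) (hvv : v < v') (hv' : v' < 1) :
    IsDisplaceable ({x : Icc (0 : ℝ) 1 | (x : ℝ) ≤ u} ×ˢ {x : Icc (0 : ℝ) 1 | (x : ℝ) ≤ v})
      ({x : Icc (0 : ℝ) 1 | (x : ℝ) < u'} ×ˢ {x : Icc (0 : ℝ) 1 | (x : ℝ) < v'}) := by
  have key : ∀ a b : ℝ, 0 < a → a < b → b < 1 → ∃ φ : Icc (0 : ℝ) 1 ≃ₜ Icc (0 : ℝ) 1,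
      (∀ x : Icc (0 : ℝ) 1, (x : ℝ) ≤ a → (φ x : ℝ) ≤ 1 / 8) ∧ ∀ x, (φ x : ℝ) < 1 / 2 → (x : ℝ) < b := by
    intro a b ha hab hb
    obtain ⟨f, hf, hfa, hfb, -⟩ := exists_mem_increasingFns (a := ⟨a, ha.le, by linarith⟩)
      (b := ⟨b, by linarith, hb.le⟩) (α := 1 / 8) (β := 1 / 2) ha hab hb (by norm_num)
      (by norm_num) (by norm_num)
    obtain ⟨φ, hφ⟩ := exists_homeomorph_of_mem_increasingFns hf
    refine ⟨φ, fun x hx => ?_, fun x hx => ?_⟩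
    · rw [hφ, ← hfa]; exact hf.1.monotone hx
    · rw [hφ, ← hfb] at hx; exact hf.1.lt_iff_lt.1 hx
  obtain ⟨φ, hφ1, hφ2⟩ := key u u' hu huu hu'
  obtain ⟨ψ, hψ1, hψ2⟩ := key v v' hv hvv hv'
  obtain ⟨T, hT1, -, -, hT4⟩ := exists_corner_homeomorph (β := 1 / 2) (by norm_num) (by norm_num)
  have h := ((isDisplaceable_Icc (c' := 0) (c := 1 / 16) (d := 3 / 8) (d' := 1 / 2) le_rfl
    (by norm_num) (by norm_num) (by norm_num) (by norm_num)).prod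
    (κ' := {x : Icc (0 : ℝ) 1 | (x : ℝ) ≤ 1 / 8}) (O' := {x : Icc (0 : ℝ) 1 | (x : ℝ) < 1 / 2})
    (isClosed_le (by fun_prop) (by fun_prop)) (isOpen_lt (by fun_prop) (by fun_prop))
    (fun x hx => lt_of_le_of_lt (show (x : ℝ) ≤ 1 / 8 from hx) (by norm_num))).preimage
    ((φ.prodCongr ψ).trans T)
  refine h.mono ?_ ?_
  · rintro ⟨x, y⟩ ⟨hx, hy⟩
    have a1 := hφ1 x hx
    have a2 := hψ1 y hy
    have e := hT4 (φ x, ψ y) (by simp only; linarith) (by simp only; linarith)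
    have e1 : (1 / 16 : ℝ) ≤ (T (φ x, ψ y)).1 := by linarith [e.1]
    have e2 : ((T (φ x, ψ y)).1 : ℝ) ≤ 3 / 8 := by linarith [e.2.1]
    have e3 : ((T (φ x, ψ y)).2 : ℝ) ≤ 1 / 8 := by linarith [e.2.2]
    exact ⟨⟨e1, e2⟩, e3⟩
  · rintro ⟨x, y⟩ ⟨hx, hy⟩
    have hx' : ((T (φ x, ψ y)).1 : ℝ) < 1 / 2 := hx.2
    have hy' : ((T (φ x, ψ y)).2 : ℝ) < 1 / 2 := hy
    by_cases hc : 1 / 2 ≤ (φ x : ℝ) ∨ 1 / 2 ≤ (ψ y : ℝ)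
    · rw [hT1 _ hc] at hx' hy'
      simp only at hx' hy'
      rcases hc with h | h <;> linarith
    · push Not at hc
      exact ⟨hφ2 x hc.1, hψ2 y hc.2⟩

/-- `J` is a closed piece of the interval well inside the open piece `O`. -/
def IsCell (J O : Set (Icc (0 : ℝ) 1)) : Prop :=
  IsClosed J ∧ IsOpen O ∧ J ⊆ O ∧
  ((∃ c' c d d' : ℝ, 0 ≤ c' ∧ c' < c ∧ c ≤ d ∧ d < d' ∧ d' ≤ 1 ∧
      J ⊆ {x | (x : ℝ) ∈ Icc c d} ∧ {x : Icc (0 : ℝ) 1 | (x : ℝ) ∈ Ioo c' d'} ⊆ O) ∨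
    (∃ u u' : ℝ, 0 < u ∧ u < u' ∧ u' < 1 ∧
      ((J ⊆ {x | (x : ℝ) ≤ u} ∧ {x : Icc (0 : ℝ) 1 | (x : ℝ) < u'} ⊆ O) ∨
      (J ⊆ {x | 1 - (x : ℝ) ≤ u} ∧ {x : Icc (0 : ℝ) 1 | 1 - (x : ℝ) < u'} ⊆ O))))

theorem IsCell.isDisplaceable_prod {J O J' O' : Set (Icc (0 : ℝ) 1)} (h : IsCell J O)
    (h' : IsCell J' O') : IsDisplaceable (J ×ˢ J') (O ×ˢ O') := by
  obtain ⟨hJ, hO, hJO, h⟩ := h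
  obtain ⟨hJ', hO', hJO', h'⟩ := h'
  rcases h with ⟨c', c, d, d', h0, h1, h2, h3, h4, h5, h6⟩ | ⟨u, u', hu, huu, hu', h⟩
  · exact ((isDisplaceable_Icc h0 h1 h2 h3 h4).mono h5 h6).prod hJ' hO' hJO'
  rcases h' with ⟨c', c, d, d', h0, h1, h2, h3, h4, h5, h6⟩ | ⟨v, v', hv, hvv, hv', h'⟩
  · exact ((((isDisplaceable_Icc h0 h1 h2 h3 h4).mono h5 h6).prod hJ hO hJO).preimage
      (Homeomorph.prodComm _ _)).mono (fun p hp => ⟨hp.2, hp.1⟩) (fun p hp => ⟨hp.2, hp.1⟩)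
  have key := isDisplaceable_corner hu huu hu' hv hvv hv'
  have key2 : ∀ χ χ' : Icc (0 : ℝ) 1 ≃ₜ Icc (0 : ℝ) 1, (∀ x ∈ J, (χ x : ℝ) ≤ u) →
      (∀ x, (χ x : ℝ) < u' → x ∈ O) → (∀ x ∈ J', (χ' x : ℝ) ≤ v) →
      (∀ x, (χ' x : ℝ) < v' → x ∈ O') → IsDisplaceable (J ×ˢ J') (O ×ˢ O') :=
    fun χ χ' a1 a2 a3 a4 => (key.preimage (χ.prodCongr χ')).mono
      (fun p hp => ⟨a1 _ hp.1, a3 _ hp.2⟩) (fun p hp => ⟨a2 _ hp.1, a4 _ hp.2⟩)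
  rcases h with ⟨ha, hb⟩ | ⟨ha, hb⟩ <;> rcases h' with ⟨ha', hb'⟩ | ⟨ha', hb'⟩
  · exact key2 (.refl _) (.refl _) ha hb ha' hb'
  · exact key2 (.refl _) unitInterval.symmHomeomorph ha hb ha' hb'
  · exact key2 unitInterval.symmHomeomorph (.refl _) ha hb ha' hb'
  · exact key2 unitInterval.symmHomeomorph unitInterval.symmHomeomorph ha hb ha' hb'

theorem exists_fiberwise_flow {Z Y A : Type*} [TopologicalSpace Z] [TopologicalSpace Y]
    {O : A → Set Z} (hdis : Pairwise fun a b => Disjoint (O a) (O b)) {σ : A → ℝ → Z → Z}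
    (h1 : ∀ a, Continuous fun p : ℝ × Z => σ a p.1 p.2) (h2 : ∀ a p, σ a 0 p = p)
    (h3 : ∀ a s t p, σ a (s + t) p = σ a s (σ a t p)) (h4 : ∀ a t, ∀ p ∉ O a, σ a t p = p)
    (r : A → C(Y, ℝ)) (s : Finset A) :
    ∃ Λ : (Z × Y) ≃ₜ (Z × Y), (∀ p, (Λ p).2 = p.2) ∧
      (∀ a ∈ s, ∀ p : Z × Y, p.1 ∈ O a → (Λ p).1 = σ a (r a p.2) p.1) ∧
      ∀ p : Z × Y, (∀ a ∈ s, p.1 ∉ O a) → Λ p = p := by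
  classical
  have hinv : ∀ a t p, σ a (-t) (σ a t p) = p := fun a t p => by rw [← h3]; simp [h2]
  have hmem : ∀ a t, ∀ p ∈ O a, σ a t p ∈ O a := by
    intro a t p hp
    by_contra h
    have := h4 a (-t) _ h
    rw [hinv] at this
    exact h (this ▸ hp)
  induction s using Finset.induction_on with
  | empty => exact ⟨.refl _, by simp, by simp, by simp⟩
  | insert b s hb ih =>
    obtain ⟨Λ, e1, e2, e3⟩ := ih
    have hc : ∀ u : C(Y, ℝ), Continuous fun p : Z × Y => (σ b (u p.2) p.1, p.2) := fun u =>
      ((h1 b).comp (show Continuous fun p : Z × Y => (u p.2, p.1) by fun_prop)).prodMk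
        continuous_snd
    let B : (Z × Y) ≃ₜ (Z × Y) :=
      { toFun := fun p => (σ b (r b p.2) p.1, p.2)
        invFun := fun p => (σ b (-(r b p.2)) p.1, p.2)
        left_inv := fun p => by simp [hinv]
        right_inv := fun p => by
          have := hinv b (-(r b p.2)) p.1
          rw [neg_neg] at this
          simp [this]
        continuous_toFun := hc (r b)
        continuous_invFun := hc (-(r b)) }
    have hB : ∀ p, B p = (σ b (r b p.2) p.1, p.2) := fun p => rfl
    refine ⟨Λ.trans B, fun p => by simp [hB, e1], fun a ha p hp => ?_, fun p hp => ?_⟩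
    · rcases Finset.mem_insert.1 ha with rfl | ha
      · have : Λ p = p := e3 p fun a' ha' h =>
          disjoint_left.1 (hdis (show a' ≠ a from fun h => hb (h ▸ ha'))) h hp
        simp [hB, this]
      · have hab : a ≠ b := fun h => hb (h ▸ ha)
        simp only [Homeomorph.trans_apply, hB]
        rw [e2 a ha p hp, h4 b]
        exact disjoint_left.1 (hdis hab) (hmem a _ _ hp)
    · have : Λ p = p := e3 p fun a ha => hp a (Finset.mem_insert_of_mem ha)
      simp [hB, this, h4 b _ _ (hp b (Finset.mem_insert_self _ _))]

theorem exists_disjoint_shadows {Z Y A J : Type*} [TopologicalSpace Z] [T2Space Z]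
    [CompactSpace Z] [TopologicalSpace Y] [T2Space Y] [CompactSpace Y] [Finite A] [Finite J]
    {κ O : A → Set Z} (hκ : ∀ a, IsClosed (κ a)) (hκO : ∀ a, κ a ⊆ O a)
    (hd : ∀ a, IsDisplaceable (κ a) (O a)) (hdis : Pairwise fun a b => Disjoint (O a) (O b))
    {P : J → Set (Z × Y)} (hP : ∀ j, IsClosed (P j))
    (hPP : ∀ i j, i ≠ j → ∀ a, ∀ p ∈ κ a, ∀ p' ∈ κ a, ∀ y, (p, y) ∈ P i → (p', y) ∉ P j) :
    ∃ Λ : (Z × Y) ≃ₜ (Z × Y), (∀ p, (Λ p).2 = p.2) ∧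
      Pairwise fun i j => Disjoint
        ((fun p => (Λ p).1) '' (P i ∩ {p | ∃ a, p.1 ∈ κ a}))
        ((fun p => (Λ p).1) '' (P j ∩ {p | ∃ a, p.1 ∈ κ a})) := by
  classical
  have := Fintype.ofFinite A
  choose σ h1 h2 h3 h4 L hL using hd
  obtain ⟨n, ⟨φ⟩⟩ := Finite.exists_equiv_fin J
  have hr : ∀ a, ∃ r : C(Y, ℝ), ∀ j, ∀ p : Z × Y, p ∈ P j → p.1 ∈ κ a →
      r p.2 = (φ j : ℕ) * (|L a| + 1) := by
    intro a
    obtain ⟨r, -, hr⟩ := exists_continuous_eqOn_finite_convex (X := Y) (E := ℝ) convex_univ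
      (mem_univ 0) (D := fun j => Prod.snd '' (P j ∩ Prod.fst ⁻¹' κ a))
      (fun j => (((hP j).inter ((hκ a).preimage continuous_fst)).isCompact.image
        continuous_snd).isClosed) (fun i j hij => by
          refine disjoint_left.2 ?_
          rintro _ ⟨⟨p, y⟩, ⟨hp, hpa⟩, rfl⟩ ⟨⟨p', y'⟩, ⟨hp', hpa'⟩, rfl⟩
          exact hPP i j hij a p hpa p' hpa' _ hp hp')
      (f := fun j => (φ j : ℕ) * (|L a| + 1)) (fun _ => mem_univ _)
    exact ⟨r, fun j p hp hpa => hr j _ ⟨p, ⟨hp, hpa⟩, rfl⟩⟩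
  choose r hr using hr
  obtain ⟨Λ, e1, e2, e3⟩ := exists_fiberwise_flow hdis h1 h2 h3 h4 r Finset.univ
  refine ⟨Λ, e1, ?_⟩
  have hinv : ∀ a t p, σ a (-t) (σ a t p) = p := fun a t p => by rw [← h3]; simp [h2]
  have hmem : ∀ a t, ∀ p ∈ O a, σ a t p ∈ O a := by
    intro a t p hp
    by_contra h
    have := h4 a (-t) _ h
    rw [hinv] at this
    exact h (this ▸ hp)
  have key : ∀ i j, (φ i : ℕ) < φ j → ∀ p q : Z × Y, p ∈ P i → q ∈ P j → ∀ a b,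
      p.1 ∈ κ a → q.1 ∈ κ b → (Λ p).1 = (Λ q).1 → False := by
    intro i j hij p q hp hq a b hpa hqb h
    rw [e2 a (Finset.mem_univ a) p (hκO a hpa), e2 b (Finset.mem_univ b) q (hκO b hqb)] at h
    by_cases hab : a = b
    · subst hab
      rw [hr a i p hp hpa, hr a j q hq hqb] at h
      have h' := congrArg (σ a (-((φ i : ℕ) * (|L a| + 1)))) h
      rw [hinv, ← h3] at h'
      refine hL a _ ?_ q.1 hqb (h' ▸ hpa)
      have : ((φ i : ℕ) : ℝ) + 1 ≤ (φ j : ℕ) := by exact_mod_cast hij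
      nlinarith [le_abs_self (L a), abs_nonneg (L a)]
    · exact disjoint_left.1 (hdis hab) (hmem a _ _ (hκO a hpa)) (h ▸ hmem b _ _ (hκO b hqb))
  intro i j hij
  rw [disjoint_left]
  rintro _ ⟨p, ⟨hp, a, hpa⟩, rfl⟩ ⟨q, ⟨hq, b, hqb⟩, h⟩
  have hne : (φ i : ℕ) ≠ φ j := fun h => hij (φ.injective (Fin.ext h))
  rcases lt_or_gt_of_ne hne with h' | h'
  · exact key i j h' p q hp hq a b hpa hqb h.symm
  · exact key j i h' q p hq hp b a hqb hpa h

theorem exists_side_homeomorph {β : ℝ} (hβ0 : 0 < β) (hβ1 : β < 1) :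
    ∃ R : (Icc (0 : ℝ) 1 × Icc (0 : ℝ) 1) ≃ₜ (Icc (0 : ℝ) 1 × Icc (0 : ℝ) 1),
      (∀ p, |((R p).1 : ℝ) - p.1| ≤ 2 * β) ∧ (∀ p, (p.2 : ℝ) = 1 → R p = p) ∧
      ∀ p, (p.2 : ℝ) = 0 → ((R p).2 : ℝ) = 0 ∧ 0 < ((R p).1 : ℝ) ∧ ((R p).1 : ℝ) < 1 := by
  obtain ⟨T, h1, h2, h3, -⟩ := exists_corner_homeomorph hβ0 hβ1.le
  let σ : (Icc (0 : ℝ) 1 × Icc (0 : ℝ) 1) ≃ₜ (Icc (0 : ℝ) 1 × Icc (0 : ℝ) 1) :=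
    unitInterval.symmHomeomorph.prodCongr (.refl _)
  have hσ1 : ∀ p, ((σ p).1 : ℝ) = 1 - p.1 := fun p => rfl
  have hσ2 : ∀ p, (σ p).2 = p.2 := fun p => rfl
  have hσσ : ∀ p, σ (σ p) = p := fun p => Prod.ext (by apply Subtype.ext; simp [hσ1]) rfl
  refine ⟨T.trans (σ.trans (T.trans σ)), fun p => ?_, fun p hp => ?_, fun p hp => ?_⟩
  · simp only [Homeomorph.trans_apply, hσ1]
    have a := abs_le.1 (h2 p)
    have b := abs_le.1 (h2 (σ (T p)))
    rw [hσ1] at b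
    rw [abs_le]
    constructor <;> linarith
  · have e : T p = p := h1 p (Or.inr (by rw [hp]; exact hβ1.le))
    have e' : T (σ p) = σ p := h1 _ (Or.inr (by rw [hσ2, hp]; exact hβ1.le))
    simp [e, e', hσσ]
  · simp only [Homeomorph.trans_apply, hσ1, hσ2]
    obtain ⟨a1, a2⟩ := h3 p hp
    obtain ⟨b1, b2⟩ := h3 (σ (T p)) (by rw [hσ2]; exact a1)
    rw [hσ1] at b2
    have p0 := p.1.2.1
    have p1 := p.1.2.2
    refine ⟨b1, ?_, ?_⟩
    · rw [b2]
      rcases max_cases 0 (β - (p.1 : ℝ)) with h | h <;>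
      rcases max_cases 0 (β - (1 - ((T p).1 : ℝ))) with h' | h' <;> linarith
    · rw [b2]
      rcases max_cases 0 (β - (p.1 : ℝ)) with h | h <;>
      rcases max_cases 0 (β - (1 - ((T p).1 : ℝ))) with h' | h' <;> linarith

theorem exists_two_sides_homeomorph {ε : ℝ} (hε : 0 < ε) :
    ∃ R : (Icc (0 : ℝ) 1 × Icc (0 : ℝ) 1) ≃ₜ (Icc (0 : ℝ) 1 × Icc (0 : ℝ) 1),
      (∀ p, |((R p).1 : ℝ) - p.1| ≤ ε) ∧
      ∀ p, (p.2 : ℝ) = 0 ∨ (p.2 : ℝ) = 1 → (((R p).2 : ℝ) = 0 ∨ ((R p).2 : ℝ) = 1) ∧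
        0 < ((R p).1 : ℝ) ∧ ((R p).1 : ℝ) < 1 := by
  obtain ⟨R, h1, h2, h3⟩ := exists_side_homeomorph (β := min (ε / 4) (1 / 2)) (by positivity)
    ((min_le_right _ _).trans_lt (by norm_num))
  have hβ : 2 * min (ε / 4) (1 / 2) ≤ ε / 2 := by linarith [min_le_left (ε / 4) (1 / 2)]
  let σ : (Icc (0 : ℝ) 1 × Icc (0 : ℝ) 1) ≃ₜ (Icc (0 : ℝ) 1 × Icc (0 : ℝ) 1) :=
    (Homeomorph.refl _).prodCongr unitInterval.symmHomeomorph
  have hσ1 : ∀ p, (σ p).1 = p.1 := fun p => rfl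
  have hσ2 : ∀ p, ((σ p).2 : ℝ) = 1 - p.2 := fun p => rfl
  have hσσ : ∀ p, σ (σ p) = p := fun p => Prod.ext rfl (by apply Subtype.ext; simp [hσ2])
  refine ⟨R.trans (σ.trans (R.trans σ)), fun p => ?_, fun p hp => ?_⟩
  · simp only [Homeomorph.trans_apply, hσ1]
    have a := abs_le.1 ((h1 p).trans hβ)
    have b := abs_le.1 ((h1 (σ (R p))).trans hβ)
    rw [hσ1] at b
    rw [abs_le]
    constructor <;> linarith
  · simp only [Homeomorph.trans_apply, hσ1, hσ2]
    rcases hp with hp | hp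
    · obtain ⟨a, b⟩ := h3 p hp
      have e := h2 (σ (R p)) (by rw [hσ2, a]; norm_num)
      rw [e, hσ1, hσ2, a]
      exact ⟨by norm_num, b⟩
    · rw [h2 p hp]
      obtain ⟨a, b⟩ := h3 (σ p) (by rw [hσ2, hp]; norm_num)
      rw [a]
      exact ⟨by norm_num, b⟩

theorem exists_homeomorph_update_pair {X : Type*} [TopologicalSpace X] (R : (X × X) ≃ₜ (X × X))
    {i w : ℕ} (hiw : i ≠ w) : ∃ Θ : (ℕ → X) ≃ₜ (ℕ → X),
      ∀ q, Θ q i = (R (q i, q w)).1 ∧ Θ q w = (R (q i, q w)).2 ∧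
        ∀ j, j ≠ i → j ≠ w → Θ q j = q j := by
  let f : (X × X → X × X) → (ℕ → X) → ℕ → X := fun R q =>
    Function.update (Function.update q i (R (q i, q w)).1) w (R (q i, q w)).2
  have hf : ∀ R q, f R q i = (R (q i, q w)).1 ∧ f R q w = (R (q i, q w)).2 ∧
      ∀ j, j ≠ i → j ≠ w → f R q j = q j := fun R q =>
    ⟨by simp [f, hiw], by simp [f], fun j h1 h2 => by simp [f, h1, h2]⟩
  have hff : ∀ R R' : X × X → X × X, (∀ p, R (R' p) = p) → ∀ q, f R (f R' q) = q := by
    intro R R' h q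
    obtain ⟨a1, a2, a3⟩ := hf R' q
    obtain ⟨b1, b2, b3⟩ := hf R (f R' q)
    rw [a1, a2, Prod.mk.eta, h] at b1 b2
    funext j
    by_cases hji : j = i
    · rw [hji, b1]
    by_cases hjw : j = w
    · rw [hjw, b2]
    rw [b3 j hji hjw, a3 j hji hjw]
  have hc : ∀ R : X × X → X × X, Continuous R → Continuous (f R) := fun R hR => by
    simp only [f]
    exact (continuous_id.update i (by fun_prop)).update w (by fun_prop)
  exact ⟨⟨⟨f R, f R.symm, hff _ _ R.symm_apply_apply, hff _ _ R.apply_symm_apply⟩,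
    hc _ R.continuous, hc _ R.symm.continuous⟩, hf R⟩

theorem exists_homeomorph_avoid_faces {ε : ℝ} (hε : 0 < ε) (w M : ℕ) (hM : M ≤ w) :
    ∃ Φ : HilbertCube ≃ₜ HilbertCube, (∀ q i, M ≤ i → i ≠ w → Φ q i = q i) ∧
      (∀ q i, i < M → |(Φ q i : ℝ) - q i| ≤ ε) ∧
      ∀ q, (q w : ℝ) = 0 ∨ (q w : ℝ) = 1 → ((Φ q w : ℝ) = 0 ∨ (Φ q w : ℝ) = 1) ∧
        ∀ i < M, 0 < (Φ q i : ℝ) ∧ (Φ q i : ℝ) < 1 := by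
  induction M with
  | zero => exact ⟨.refl _, by simp, by simp, by simp⟩
  | succ M ih =>
    obtain ⟨Φ, h1, h2, h3⟩ := ih (by omega)
    obtain ⟨R, r1, r2⟩ := exists_two_sides_homeomorph hε
    obtain ⟨Θ, hΘ⟩ := exists_homeomorph_update_pair R (show M ≠ w by omega)
    refine ⟨Φ.trans Θ, fun q i hi hiw => ?_, fun q i hi => ?_, fun q hq => ?_⟩
    · rw [Homeomorph.trans_apply, (hΘ _).2.2 i (by omega) hiw, h1 q i (by omega) hiw]
    · rw [Homeomorph.trans_apply]
      rcases Nat.lt_succ_iff_lt_or_eq.1 hi with hi | rfl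
      · rw [(hΘ _).2.2 i (by omega) (by omega)]
        exact h2 q i hi
      · rw [(hΘ _).1]
        have := r1 (Φ q i, Φ q w)
        rwa [h1 q i le_rfl (by omega)] at this ⊢
    · obtain ⟨a, b⟩ := h3 q hq
      obtain ⟨c, d⟩ := r2 (Φ q M, Φ q w) a
      rw [Homeomorph.trans_apply, (hΘ _).2.1]
      refine ⟨c, fun i hi => ?_⟩
      rcases Nat.lt_succ_iff_lt_or_eq.1 hi with hi | rfl
      · rw [(hΘ _).2.2 i (by omega) (by omega)]
        exact b i hi
      · rw [(hΘ _).1]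
        exact d

theorem exists_pos_le_of_avoid_faces {Φ : HilbertCube → HilbertCube} (hΦ : Continuous Φ)
    {w M : ℕ} (h : ∀ q, (q w : ℝ) = 0 ∨ (q w : ℝ) = 1 →
      ∀ i < M, 0 < (Φ q i : ℝ) ∧ (Φ q i : ℝ) < 1) :
    ∃ c > 0, ∀ q, ((q w : ℝ) < c ∨ 1 - (q w : ℝ) < c) →
      ∀ i < M, c ≤ (Φ q i : ℝ) ∧ (Φ q i : ℝ) ≤ 1 - c := by
  induction M with
  | zero => exact ⟨1, one_pos, by simp⟩
  | succ M ih =>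
    obtain ⟨c, hc, hc'⟩ := ih fun q hq i hi => h q hq i (by omega)
    let G : HilbertCube → ℝ := fun q =>
      max (min (q w : ℝ) (1 - q w)) (min (Φ q M : ℝ) (1 - Φ q M))
    have hG : Continuous G := by
      have : Continuous fun q => Φ q M := (continuous_apply M).comp hΦ
      simp only [G]
      fun_prop
    obtain ⟨q₀, -, hq₀⟩ := isCompact_univ.exists_isMinOn (univ_nonempty (α := HilbertCube))
      hG.continuousOn
    have hpos : 0 < G q₀ := by
      by_cases h0 : (q₀ w : ℝ) = 0 ∨ (q₀ w : ℝ) = 1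
      · obtain ⟨a, b⟩ := h q₀ h0 M (by omega)
        exact lt_max_of_lt_right (lt_min a (by linarith))
      · push Not at h0
        have a := lt_of_le_of_ne (q₀ w).2.1 (Ne.symm h0.1)
        have b := lt_of_le_of_ne (q₀ w).2.2 h0.2
        exact lt_max_of_lt_left (lt_min a (by linarith))
    refine ⟨min c (G q₀), lt_min hc hpos, fun q hq i hi => ?_⟩
    rcases Nat.lt_succ_iff_lt_or_eq.1 hi with hi | rfl
    · obtain ⟨a, b⟩ := hc' q (hq.imp (fun h => h.trans_le (min_le_left _ _))
        fun h => h.trans_le (min_le_left _ _)) i hi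
      have := min_le_left c (G q₀)
      constructor <;> linarith
    · have h1 : G q₀ ≤ G q := hq₀ (mem_univ q)
      have h2 := min_le_right c (G q₀)
      have h3 : min (q w : ℝ) (1 - q w) < G q₀ := by
        rcases hq with h | h
        · exact (min_le_left _ _).trans_lt (h.trans_le h2)
        · exact (min_le_right _ _).trans_lt (h.trans_le h2)
      have h4 : G q₀ ≤ min (Φ q i : ℝ) (1 - Φ q i) := by
        rcases le_max_iff.1 h1 with h | h
        · linarith
        · exact h
      have h5 := h4.trans (min_le_left _ _)
      have h6 := h4.trans (min_le_right _ _)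
      constructor <;> linarith

theorem exists_homeomorph_fiberwise_increasing (z y : ℕ)
    (Φ : ℕ → C(Icc (0 : ℝ) 1 × Icc (0 : ℝ) 1, C(Icc (0 : ℝ) 1, ℝ)))
    (hΦ : ∀ i p, Φ i p ∈ increasingFns) :
    ∃ H : HilbertCube ≃ₜ HilbertCube, ∀ q, H q z = q z ∧ H q y = q y ∧
      ∀ i, i ≠ z → i ≠ y → (H q i : ℝ) = Φ i (q z, q y) (q i) := by
  let g : HilbertCube → HilbertCube := fun q i => if i = z ∨ i = y then q i else
    ⟨Φ i (q z, q y) (q i), mem_Icc_of_mem_increasingFns (hΦ _ _) _⟩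
  have g1 : ∀ q i, (i = z ∨ i = y) → g q i = q i := fun q i hi => if_pos hi
  have g2 : ∀ q i, ¬ (i = z ∨ i = y) → (g q i : ℝ) = Φ i (q z, q y) (q i) := fun q i hi => by
    simp [g, hi]
  have hg : IsHomeomorph g := by
    rw [isHomeomorph_iff_continuous_bijective]
    refine ⟨continuous_pi fun i => ?_, fun q q' h => ?_, fun q => ?_⟩
    · by_cases hi : i = z ∨ i = y
      · simp only [g, hi, if_true]
        fun_prop
      · simp only [g, hi, if_false]
        refine Continuous.subtype_mk ?_ _
        fun_prop
    · have hz : q z = q' z := by simpa [g1] using congrFun h z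
      have hy : q y = q' y := by simpa [g1] using congrFun h y
      funext i
      have hi := congrFun h i
      by_cases hc : i = z ∨ i = y
      · rwa [g1 q i hc, g1 q' i hc] at hi
      · have := congrArg Subtype.val hi
        rw [g2 q i hc, g2 q' i hc, hz, hy] at this
        exact (hΦ i _).1.injective this
    · choose φ hφ using fun i => exists_homeomorph_of_mem_increasingFns (hΦ i (q z, q y))
      let q' : HilbertCube := fun i => if i = z ∨ i = y then q i else (φ i).symm (q i)
      have hz : q' z = q z := by simp [q']
      have hy : q' y = q y := by simp [q']
      refine ⟨q', ?_⟩
      funext i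
      by_cases hc : i = z ∨ i = y
      · rw [g1 q' i hc]
        simp [q', hc]
      · apply Subtype.ext
        rw [g2 q' i hc, hz, hy, ← hφ]
        simp [q', hc]
  exact ⟨hg.homeomorph g, fun q => ⟨g1 q z (Or.inl rfl), g1 q y (Or.inr rfl),
    fun i h1 h2 => g2 q i (by simp [h1, h2])⟩⟩

theorem exists_cells (K N : ℕ) (hN : 0 < N) :
    ∃ J O : ℕ → Fin (N + 1) → Set (Icc (0 : ℝ) 1),
      (∀ e < K, ∀ a, IsCell (J e a) (O e a)) ∧
      (∀ e, Pairwise fun a b => Disjoint (O e a) (O e b)) ∧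
      (∀ e a, ∀ s ∈ J e a, ∀ t ∈ J e a, |(s : ℝ) - t| < 1 / N) ∧
      ∀ t, ∀ e < K, ∀ e' < K, e ≠ e' → (∃ a, t ∈ J e a) ∨ ∃ a, t ∈ J e' a := by
  have hK : (0 : ℝ) < K + 1 := by positivity
  have hN' : (1 : ℝ) ≤ N := by exact_mod_cast hN
  have hN0 : (0 : ℝ) < N := by linarith
  let p : ℕ → ℝ := fun e => (e + 1) / (K + 1)
  obtain ⟨η, hη⟩ : ∃ η : ℝ, η = 1 / (4 * (K + 1)) := ⟨_, rfl⟩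
  have hη0 : 0 < η := by rw [hη]; positivity
  have hp0 : ∀ e, 4 * η ≤ p e := fun e => by
    simp only [p, hη]; rw [le_div_iff₀ hK]; field_simp; linarith [(Nat.cast_nonneg e : (0 : ℝ) ≤ e)]
  have hp1 : ∀ e < K, p e ≤ 1 - 4 * η := fun e he => by
    have : (e : ℝ) + 1 ≤ K := by exact_mod_cast he
    simp only [p, hη]; rw [div_le_iff₀ hK]; field_simp; linarith
  let J : ℕ → Fin (N + 1) → Set (Icc (0 : ℝ) 1) := fun e a =>
    {t | ((a : ℕ) : ℝ) - 1 + p e + η ≤ t * N ∧ (t : ℝ) * N ≤ (a : ℕ) + p e - η}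
  let O : ℕ → Fin (N + 1) → Set (Icc (0 : ℝ) 1) := fun e a =>
    {t | ((a : ℕ) : ℝ) - 1 + p e < t * N ∧ (t : ℝ) * N < (a : ℕ) + p e}
  have hdiv : ∀ {x t : ℝ}, x / N ≤ t ↔ x ≤ t * N := fun {x t} => div_le_iff₀ hN0
  have hdiv' : ∀ {x t : ℝ}, t ≤ x / N ↔ t * N ≤ x := fun {x t} => le_div_iff₀ hN0
  have hc : Continuous fun t : Icc (0 : ℝ) 1 => (t : ℝ) * N := by fun_prop
  refine ⟨J, O, fun e he a => ⟨?_, ?_, ?_, ?_⟩, fun e a b hab => ?_, fun e a s hs t ht => ?_,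
    fun t e he e' he' hee => ?_⟩
  · exact (isClosed_le continuous_const hc).inter (isClosed_le hc continuous_const)
  · exact (isOpen_lt continuous_const hc).inter (isOpen_lt hc continuous_const)
  · exact fun t ht => ⟨by linarith [ht.1], by linarith [ht.2]⟩
  · have q0 := hp0 e
    have q1 := hp1 e he
    by_cases ha0 : (a : ℕ) = 0
    · refine Or.inr ⟨(p e - η) / N, p e / N, div_pos (by linarith) hN0,
        div_lt_div_of_pos_right (by linarith) hN0, (div_lt_one hN0).2 (by linarith),
        Or.inl ⟨fun t ht => ?_, fun t ht => ?_⟩⟩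
      · have := ht.2
        rw [ha0] at this
        exact hdiv'.2 (by simpa using this)
      · have h : (t : ℝ) * N < p e := (lt_div_iff₀ hN0).1 ht
        have h0 : 0 ≤ (t : ℝ) * N := mul_nonneg t.2.1 hN0.le
        refine ⟨?_, ?_⟩ <;> rw [ha0] <;> push_cast <;> linarith
    by_cases haN : (a : ℕ) = N
    · refine Or.inr ⟨(1 - p e - η) / N, (1 - p e) / N, div_pos (by linarith) hN0,
        div_lt_div_of_pos_right (by linarith) hN0, (div_lt_one hN0).2 (by linarith),
        Or.inr ⟨fun t ht => ?_, fun t ht => ?_⟩⟩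
      · have := ht.1
        rw [haN] at this
        exact hdiv'.2 (by linarith)
      · have h : (1 - (t : ℝ)) * N < 1 - p e := (lt_div_iff₀ hN0).1 ht
        have h0 : (t : ℝ) * N ≤ 1 * N := mul_le_mul_of_nonneg_right t.2.2 hN0.le
        refine ⟨?_, ?_⟩ <;> rw [haN] <;> linarith
    have a1 : (1 : ℝ) ≤ (a : ℕ) := by exact_mod_cast Nat.one_le_iff_ne_zero.2 ha0
    have a2 : ((a : ℕ) : ℝ) + 1 ≤ N := by
      have := a.2
      exact_mod_cast (by omega : (a : ℕ) + 1 ≤ N)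
    refine Or.inl ⟨((a : ℕ) - 1 + p e) / N, ((a : ℕ) - 1 + p e + η) / N,
      ((a : ℕ) + p e - η) / N, ((a : ℕ) + p e) / N, div_nonneg (by linarith) hN0.le,
      div_lt_div_of_pos_right (by linarith) hN0, div_le_div_of_nonneg_right (by linarith) hN0.le,
      div_lt_div_of_pos_right (by linarith) hN0, (div_le_one hN0).2 (by linarith),
      fun t ht => ⟨hdiv.2 ht.1, hdiv'.2 ht.2⟩,
      fun t ht => ⟨(div_lt_iff₀ hN0).1 ht.1, (lt_div_iff₀ hN0).1 ht.2⟩⟩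
  · refine disjoint_left.2 fun t hs ht => hab (Fin.ext ?_)
    have h1 : ((a : ℕ) : ℝ) < (b : ℕ) + 1 := by linarith [hs.1, ht.2]
    have h2 : ((b : ℕ) : ℝ) < (a : ℕ) + 1 := by linarith [hs.2, ht.1]
    have h1' : (a : ℕ) < b + 1 := by exact_mod_cast h1
    have h2' : (b : ℕ) < a + 1 := by exact_mod_cast h2
    omega
  · rw [lt_div_iff₀ hN0]
    calc |(s : ℝ) - t| * N = |(s : ℝ) * N - t * N| := by rw [← sub_mul, abs_mul, abs_of_pos hN0]
      _ < 1 := by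
        rw [abs_lt]
        constructor <;> linarith [hs.1, hs.2, ht.1, ht.2]
  · have key : ∀ e < K, (¬ ∃ a, t ∈ J e a) → ∃ m : ℤ, |(t : ℝ) * N - p e - m| < η := by
      intro e he h
      have q0 := hp0 e
      have q1 := hp1 e he
      have t0 : 0 ≤ (t : ℝ) * N := mul_nonneg t.2.1 hN0.le
      have t1 : (t : ℝ) * N ≤ 1 * N := mul_le_mul_of_nonneg_right t.2.2 hN0.le
      have f1 := Int.floor_le ((t : ℝ) * N - p e)
      have f2 := Int.lt_floor_add_one ((t : ℝ) * N - p e)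
      set α := ⌊(t : ℝ) * N - p e⌋
      have b1 : -1 ≤ α := by
        have : (-1 : ℝ) < α + 1 := by linarith
        have : (-1 : ℤ) < α + 1 := by exact_mod_cast this
        omega
      have b2 : α < N := by
        have : (α : ℝ) < N := by linarith
        exact_mod_cast this
      by_contra hcon
      push Not at hcon
      have c1 := hcon α
      have c2 := hcon (α + 1)
      rw [abs_of_nonneg (by linarith)] at c1
      rw [abs_of_nonpos (by push_cast; linarith)] at c2
      push_cast at c2
      refine h ⟨⟨(α + 1).toNat, by omega⟩, ?_⟩
      have hc : (((α + 1).toNat : ℕ) : ℝ) = α + 1 := by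
        have := Int.toNat_of_nonneg (show 0 ≤ α + 1 by omega)
        exact_mod_cast this
      simp only [J, mem_ofPred_eq]
      rw [hc]
      constructor <;> linarith
    by_contra hcon
    push Not at hcon
    obtain ⟨m, hm⟩ := key e he (by push Not; exact hcon.1)
    obtain ⟨m', hm'⟩ := key e' he' (by push Not; exact hcon.2)
    rw [abs_lt] at hm hm'
    have h1 : |p e' - p e - ((m - m' : ℤ) : ℝ)| < 2 * η := by
      push_cast
      rw [abs_lt]
      constructor <;> linarith
    have h2 : p e' - p e - ((m - m' : ℤ) : ℝ)
        = (((e' : ℤ) - e - (m - m') * (K + 1) : ℤ) : ℝ) / (K + 1) := by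
      simp only [p]
      push_cast
      field_simp
      ring
    rw [h2, abs_div, abs_of_pos hK, div_lt_iff₀ hK, hη] at h1
    have h3 : 2 * (1 / (4 * ((K : ℝ) + 1))) * (K + 1) = 1 / 2 := by field_simp; norm_num
    rw [h3] at h1
    have h4 : |(e' : ℤ) - e - (m - m') * (K + 1)| < 1 := by
      have : ((|(e' : ℤ) - e - (m - m') * (K + 1)| : ℤ) : ℝ) < 1 := by
        rw [Int.cast_abs]; linarith
      exact_mod_cast this
    have h5 : (e' : ℤ) - e = (m - m') * (K + 1) := by
      have := Int.abs_lt_one_iff.1 h4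
      linarith
    have h6 : (e' : ℤ) - e = 0 :=
      Int.eq_zero_of_abs_lt_dvd (m := (K : ℤ) + 1) ⟨m - m', by rw [h5]; ring⟩
        (abs_lt.2 ⟨by omega, by omega⟩)
    omega

theorem exists_homeomorph_select_increasing {J : Type*} [Finite J] (z y : ℕ)
    {D : J → Set (Icc (0 : ℝ) 1 × Icc (0 : ℝ) 1)} (hD : ∀ j, IsClosed (D j))
    (hdis : Pairwise fun i j => Disjoint (D i) (D j)) {K : ℕ → Set C(Icc (0 : ℝ) 1, ℝ)}
    (hK : ∀ l, Convex ℝ (K l)) (hKi : ∀ l, K l ⊆ increasingFns) (hK0 : ∀ l, coeUnit ∈ K l)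
    {f : ℕ → J → C(Icc (0 : ℝ) 1, ℝ)} (hf : ∀ l j, f l j ∈ K l) :
    ∃ H : HilbertCube ≃ₜ HilbertCube, ∀ q, H q z = q z ∧ H q y = q y ∧
      ∀ l, l ≠ z → l ≠ y → (∃ h ∈ K l, (H q l : ℝ) = h (q l)) ∧
        ∀ j, (q z, q y) ∈ D j → (H q l : ℝ) = f l j (q l) := by
  choose Φ h1 h2 using fun l => exists_continuous_eqOn_finite_convex (hK l) (hK0 l) hD hdis (hf l)
  obtain ⟨H, hH⟩ := exists_homeomorph_fiberwise_increasing z y Φ fun l p => hKi l (h1 l p)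
  refine ⟨H, fun q => ⟨(hH q).1, (hH q).2.1, fun l hz hy =>
    ⟨⟨_, h1 l _, (hH q).2.2 l hz hy⟩, fun j hj => ?_⟩⟩⟩
  rw [(hH q).2.2 l hz hy, h2 l j _ hj]

theorem exists_homeomorph_split {z y : ℕ} (hzy : z ≠ y) :
    ∃ E : HilbertCube ≃ₜ (Icc (0 : ℝ) 1 × Icc (0 : ℝ) 1) ×
      ({l : ℕ // l ≠ z ∧ l ≠ y} → Icc (0 : ℝ) 1),
      ∀ q, E q = ((q z, q y), fun l => q l.1) := by
  let g : HilbertCube → (Icc (0 : ℝ) 1 × Icc (0 : ℝ) 1) ×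
      ({l : ℕ // l ≠ z ∧ l ≠ y} → Icc (0 : ℝ) 1) := fun q => ((q z, q y), fun l => q l.1)
  have hg : IsHomeomorph g := by
    rw [isHomeomorph_iff_continuous_bijective]
    refine ⟨by fun_prop, fun q q' h => ?_, fun p => ?_⟩
    · simp only [g, Prod.mk.injEq] at h
      funext l
      by_cases hz : l = z
      · rw [hz, h.1.1]
      by_cases hy : l = y
      · rw [hy, h.1.2]
      exact congrFun h.2 ⟨l, hz, hy⟩
    · refine ⟨fun l => if hz : l = z then p.1.1 else if hy : l = y then p.1.2 else
        p.2 ⟨l, hz, hy⟩, ?_⟩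
      refine Prod.ext (Prod.ext ?_ ?_) ?_
      · simp [g]
      · simp [g, hzy.symm]
      · funext l
        simp [g, l.2.1, l.2.2]
  exact ⟨hg.homeomorph g, fun q => rfl⟩

theorem exists_homeomorph_disjoint_shadows {A J : Type*} [Finite A] [Finite J] {z y : ℕ}
    (hzy : z ≠ y) {κ O : A → Set (Icc (0 : ℝ) 1 × Icc (0 : ℝ) 1)} (hκ : ∀ a, IsClosed (κ a))
    (hκO : ∀ a, κ a ⊆ O a) (hd : ∀ a, IsDisplaceable (κ a) (O a))
    (hdis : Pairwise fun a b => Disjoint (O a) (O b)) {P : J → Set HilbertCube}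
    (hP : ∀ j, IsClosed (P j))
    (hPP : ∀ i j, i ≠ j → ∀ a, ∀ q ∈ P i, ∀ q' ∈ P j, (q z, q y) ∈ κ a → (q' z, q' y) ∈ κ a →
      ∃ l, l ≠ z ∧ l ≠ y ∧ q l ≠ q' l) :
    ∃ (Λ : HilbertCube ≃ₜ HilbertCube) (D : J → Set (Icc (0 : ℝ) 1 × Icc (0 : ℝ) 1)),
      (∀ q l, l ≠ z → l ≠ y → Λ q l = q l) ∧ (∀ j, IsClosed (D j)) ∧
      (Pairwise fun i j => Disjoint (D i) (D j)) ∧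
      ∀ j, ∀ q ∈ P j, (∃ a, (q z, q y) ∈ κ a) → (Λ q z, Λ q y) ∈ D j := by
  obtain ⟨E, hE⟩ := exists_homeomorph_split hzy
  have hE' : ∀ p, p = ((E.symm p z, E.symm p y), fun l => E.symm p l.1) := fun p => by
    rw [← hE, E.apply_symm_apply]
  obtain ⟨Λ, h1, h2⟩ := exists_disjoint_shadows hκ hκO hd hdis
    (P := fun j => E.symm ⁻¹' P j) (fun j => (hP j).preimage E.symm.continuous) (by
      intro i j hij a p hp p' hp' u hu hu'
      have e := hE' (p, u)
      have e' := hE' (p', u)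
      simp only [Prod.mk.injEq] at e e'
      obtain ⟨l, hz, hy, hl⟩ := hPP i j hij a _ hu _ hu' (by rwa [← e.1]) (by rwa [← e'.1])
      exact hl (congrFun (e.2.symm.trans e'.2) ⟨l, hz, hy⟩))
  refine ⟨E.trans (Λ.trans E.symm), fun j => (fun p => (Λ p).1) ''
    (E.symm ⁻¹' P j ∩ {p | ∃ a, p.1 ∈ κ a}), fun q l hz hy => ?_, fun j => ?_, h2,
    fun j q hq hqa => ?_⟩
  · have e := congrArg Prod.snd (hE' (Λ (E q)))
    rw [h1] at e
    exact congrFun (e.symm.trans (congrArg Prod.snd (hE q))) ⟨l, hz, hy⟩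
  · have : {p : (Icc (0 : ℝ) 1 × Icc (0 : ℝ) 1) ×
        ({l : ℕ // l ≠ z ∧ l ≠ y} → Icc (0 : ℝ) 1) | ∃ a, p.1 ∈ κ a} =
        ⋃ a, Prod.fst ⁻¹' κ a := by ext; simp
    rw [this]
    exact ((((hP j).preimage E.symm.continuous).inter (isClosed_iUnion_of_finite fun a =>
      (hκ a).preimage continuous_fst)).isCompact.image (by fun_prop)).isClosed
  · refine ⟨E q, ⟨by simpa using hq, by simpa [hE] using hqa⟩, ?_⟩
    exact congrArg Prod.fst (hE' (Λ (E q)))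

theorem exists_homeomorph_pieces_into {A J : Type*} [Finite A] [Finite J] {m M : ℕ} (hm : m ≤ M)
    {ε : ℝ} (hε : 0 < ε) {κ O : A → Set (Icc (0 : ℝ) 1 × Icc (0 : ℝ) 1)}
    (hκ : ∀ a, IsClosed (κ a)) (hκO : ∀ a, κ a ⊆ O a) (hd : ∀ a, IsDisplaceable (κ a) (O a))
    (hdis : Pairwise fun a b => Disjoint (O a) (O b)) {P : J → Set HilbertCube}
    (hP : ∀ j, IsClosed (P j))
    (hPP : ∀ i j, i ≠ j → ∀ a, ∀ q ∈ P i, ∀ q' ∈ P j, (q M, q (M + 1)) ∈ κ a →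
      (q' M, q' (M + 1)) ∈ κ a → ∃ l, l ≠ M ∧ l ≠ M + 1 ∧ q l ≠ q' l)
    (hsmall : ∀ j, ∃ x : HilbertCube, ∀ q ∈ P j, ∀ l < M, |(q l : ℝ) - x l| ≤ ε)
    (hw : ∀ j, (∀ q ∈ P j, (q (M + 2) : ℝ) ≤ 2 / 3) ∨ ∀ q ∈ P j, 1 / 3 ≤ (q (M + 2) : ℝ))
    {U : Set HilbertCube}
    (hU : ∀ x : HilbertCube, ∃ α β : ℕ → ℝ, (∀ l < M, 0 < α l ∧ α l < β l ∧ β l < 1) ∧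
      (∀ l < m, |α l - x l| ≤ ε ∧ |β l - x l| ≤ ε) ∧
      ∀ q : HilbertCube, (∀ l < M, α l ≤ q l ∧ (q l : ℝ) ≤ β l) → q ∈ U) :
    ∃ g : HilbertCube ≃ₜ HilbertCube, (∀ q, ∀ l < m, |(g q l : ℝ) - q l| ≤ 4 * ε) ∧
      ∀ j, ∀ q ∈ P j, (∃ a, (q M, q (M + 1)) ∈ κ a) → g q ∈ U := by
  classical
  obtain ⟨Λ, D, L1, L2, L3, L4⟩ := exists_homeomorph_disjoint_shadows (show M ≠ M + 1 by omega)
    hκ hκO hd hdis hP hPP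
  obtain ⟨Φ, F1, F2, F3⟩ := exists_homeomorph_avoid_faces hε (M + 2) M (by omega)
  obtain ⟨c, hc, F4⟩ := exists_pos_le_of_avoid_faces Φ.continuous fun q hq => (F3 q hq).2
  obtain ⟨δ, hδ0, hδc, hδ1⟩ : ∃ δ : ℝ, 0 < δ ∧ δ < c ∧ δ < 1 :=
    ⟨min c 1 / 2, by positivity, by linarith [min_le_left c 1, lt_min hc one_pos],
      by linarith [min_le_right c 1]⟩
  obtain ⟨h₀, hh0, hhc, hhε, hh1⟩ : ∃ h : ℝ, 0 < h ∧ h ≤ c ∧ h ≤ ε ∧ h ≤ 1 / 4 :=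
    ⟨min c (min ε (1 / 4)), by positivity, min_le_left _ _,
      (min_le_right _ _).trans (min_le_left _ _), (min_le_right _ _).trans (min_le_right _ _)⟩
  choose x hx using hsmall
  choose α β hαβ hαx hαU using fun j => hU (x j)
  -- pushing `w` towards the ends
  have hWf : ∀ j, ∃ f ∈ increasingFns, ∀ q ∈ P j,
      f (q (M + 2)) < c ∨ 1 - f (q (M + 2)) < c := by
    intro j
    have key : ∀ α β : ℝ, 0 < α → α < β → β < 1 → ∃ f ∈ increasingFns,
        f ⟨1 / 3, by norm_num, by norm_num⟩ = α ∧ f ⟨2 / 3, by norm_num, by norm_num⟩ = β := by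
      intro α β h0 h1 h2
      obtain ⟨f, hf, h3, h4, -⟩ := exists_mem_increasingFns
        (a := ⟨1 / 3, by norm_num, by norm_num⟩) (b := ⟨2 / 3, by norm_num, by norm_num⟩)
        (by norm_num) (by norm_num) (by norm_num) h0 h1 h2
      exact ⟨f, hf, h3, h4⟩
    rcases hw j with hw | hw
    · obtain ⟨f, hf, -, h2⟩ := key (δ / 2) δ (by linarith) (by linarith) hδ1
      exact ⟨f, hf, fun q hq => Or.inl (lt_of_le_of_lt
        ((hf.1.monotone (show q (M + 2) ≤ ⟨2 / 3, by norm_num, by norm_num⟩ from hw q hq)).trans_eq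
          h2) hδc)⟩
    · obtain ⟨f, hf, h1, -⟩ := key (1 - δ) (1 - δ / 2) (by linarith) (by linarith) (by linarith)
      refine ⟨f, hf, fun q hq => Or.inr ?_⟩
      have := hf.1.monotone
        (show (⟨1 / 3, by norm_num, by norm_num⟩ : Icc (0 : ℝ) 1) ≤ q (M + 2) from hw q hq)
      linarith
  choose fW hfW hfWc using hWf
  obtain ⟨W, hW⟩ := exists_homeomorph_select_increasing M (M + 1) L2 L3
    (K := fun l => if l = M + 2 then increasingFns else {coeUnit})
    (fun l => by split_ifs; exacts [convex_increasingFns, convex_singleton _])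
    (fun l => by
      split_ifs; exacts [subset_rfl, singleton_subset_iff.2 coeUnit_mem])
    (fun l => by split_ifs; exacts [coeUnit_mem, rfl])
    (f := fun l j => if l = M + 2 then fW j else coeUnit)
    (fun l j => by split_ifs; exacts [hfW j, rfl])
  have W1 : ∀ q l, l ≠ M + 2 → W q l = q l := by
    intro q l hl
    by_cases hz : l = M
    · rw [hz, (hW q).1]
    by_cases hy : l = M + 1
    · rw [hy, (hW q).2.1]
    obtain ⟨h, hh, e⟩ := ((hW q).2.2 l hz hy).1
    rw [if_neg hl] at hh
    rw [mem_singleton_iff.1 hh] at e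
    exact Subtype.ext e
  have W2 : ∀ q j, (q M, q (M + 1)) ∈ D j → (W q (M + 2) : ℝ) = fW j (q (M + 2)) := by
    intro q j hj
    have := ((hW q).2.2 (M + 2) (by omega) (by omega)).2 j hj
    simpa using this
  -- moving the other coordinates into the boxes
  let K : ℕ → Set C(Icc (0 : ℝ) 1, ℝ) := fun l =>
    {f ∈ increasingFns | l < m → ∀ t : Icc (0 : ℝ) 1, |f t - t| ≤ 3 * ε}
  have hK : ∀ l, Convex ℝ (K l) := by
    rintro l f ⟨hf, hf'⟩ g ⟨hg, hg'⟩ s r hs hr hsr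
    refine ⟨convex_increasingFns hf hg hs hr hsr, fun hl t => ?_⟩
    have a := abs_le.1 (hf' hl t)
    have b := abs_le.1 (hg' hl t)
    simp only [ContinuousMap.add_apply, ContinuousMap.smul_apply, smul_eq_mul]
    have e : s * f t + r * g t - t = s * (f t - t) + r * (g t - t) := by
      linear_combination (t : ℝ) * hsr
    have e' : 3 * ε = s * (3 * ε) + r * (3 * ε) := by linear_combination (-(3 * ε)) * hsr
    rw [e, e', abs_le]
    constructor <;> nlinarith
  have hK0 : ∀ l, coeUnit ∈ K l := fun l => ⟨coeUnit_mem, fun _ t => by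
    simp only [coeUnit, ContinuousMap.coe_mk, sub_self, abs_zero]; positivity⟩
  have hXf : ∀ l j, ∃ f ∈ K l, l < M → ∀ t : Icc (0 : ℝ) 1, h₀ ≤ t → (t : ℝ) ≤ 1 - h₀ →
      |(t : ℝ) - x j l| ≤ 2 * ε → α j l ≤ f t ∧ f t ≤ β j l := by
    intro l j
    by_cases hl : l < M
    · have x0 := (x j l).2.1
      have x1 := (x j l).2.2
      obtain ⟨h1, h2, h3⟩ := hαβ j l hl
      obtain ⟨a, ha⟩ : ∃ a : ℝ, a = max h₀ (x j l - 2 * ε) := ⟨_, rfl⟩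
      obtain ⟨b, hb⟩ : ∃ b : ℝ, b = min (1 - h₀) (x j l + 2 * ε) := ⟨_, rfl⟩
      have ha0 : h₀ ≤ a := ha ▸ le_max_left _ _
      have hax : x j l - 2 * ε ≤ a := ha ▸ le_max_right _ _
      have hax' : a ≤ x j l + ε := ha ▸ max_le (by linarith) (by linarith)
      have hb0 : b ≤ 1 - h₀ := hb ▸ min_le_left _ _
      have hbx : b ≤ x j l + 2 * ε := hb ▸ min_le_right _ _
      have hbx' : x j l - ε ≤ b := hb ▸ le_min (by linarith) (by linarith)
      have hab : a < b := by
        rw [ha, hb]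
        exact max_lt (lt_min (by linarith) (by linarith)) (lt_min (by linarith) (by linarith))
      obtain ⟨f, hf, f1, f2, f3⟩ := exists_mem_increasingFns
        (a := ⟨a, by linarith, by linarith⟩) (b := ⟨b, by linarith, by linarith⟩)
        (show 0 < a by linarith) hab (show b < 1 by linarith) h1 h2 h3
      refine ⟨f, ⟨hf, fun hlm t => (f3 t).trans ?_⟩, fun _ t t1 t2 t3 => ?_⟩
      · obtain ⟨e1, e2⟩ := hαx j l hlm
        rw [abs_le] at e1 e2
        refine max_le ?_ ?_ <;> simp only <;> rw [abs_le] <;> constructor <;> linarith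
      · rw [abs_le] at t3
        have ta : a ≤ t := ha ▸ max_le t1 (by linarith)
        have tb : (t : ℝ) ≤ b := hb ▸ le_min t2 (by linarith)
        rw [← f1, ← f2]
        exact ⟨hf.1.monotone ta, hf.1.monotone tb⟩
    · exact ⟨coeUnit, hK0 l, fun h => absurd h hl⟩
  choose fX hfX hfX' using hXf
  obtain ⟨X, hX⟩ := exists_homeomorph_select_increasing M (M + 1) L2 L3 hK
    (fun l f hf => hf.1) hK0 hfX
  refine ⟨Λ.trans (W.trans (Φ.trans X)), fun q l hl => ?_, fun j q hq ha => hαU j _ fun l hl => ?_⟩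
  · simp only [Homeomorph.trans_apply]
    obtain ⟨h, hh, e⟩ := ((hX (Φ (W (Λ q)))).2.2 l (by omega) (by omega)).1
    have e1 := abs_le.1 (hh.2 hl (Φ (W (Λ q)) l))
    have e2 := abs_le.1 (F2 (W (Λ q)) l (by omega))
    rw [W1 _ l (by omega), L1 q l (by omega) (by omega)] at e2
    rw [e, abs_le]
    constructor <;> linarith
  · simp only [Homeomorph.trans_apply]
    have d1 := L4 j q hq ha
    have w1 := W2 (Λ q) j d1
    rw [L1 q (M + 2) (by omega) (by omega)] at w1
    obtain ⟨b1, b2⟩ := F4 (W (Λ q)) (by rw [w1]; exact hfWc j q hq) l hl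
    have e2 := abs_le.1 (F2 (W (Λ q)) l hl)
    have e3 := abs_le.1 (hx j q hq l hl)
    rw [W1 _ l (by omega), L1 q l (by omega) (by omega)] at e2
    rw [((hX (Φ (W (Λ q)))).2.2 l (by omega) (by omega)).2 j (by
      rw [F1 _ M le_rfl (by omega), F1 _ (M + 1) (by omega) (by omega), W1 _ _ (by omega),
        W1 _ _ (by omega)]
      exact d1)]
    exact hfX' l j hl _ (by linarith) (by linarith) (abs_le.2 ⟨by linarith, by linarith⟩)

theorem exists_Icc_subset_of_isOpen {u : Set (Icc (0 : ℝ) 1)} (hu : IsOpen u)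
    (hne : u.Nonempty) : ∃ α β : ℝ, 0 < α ∧ α < β ∧ β < 1 ∧
      ∀ t : Icc (0 : ℝ) 1, α ≤ t → (t : ℝ) ≤ β → t ∈ u := by
  obtain ⟨W, hW, rfl⟩ := isOpen_induced_iff.1 hu
  obtain ⟨t, ht⟩ := hne
  have hcl : (t : ℝ) ∈ closure (Ioo (0 : ℝ) 1) := by
    rw [closure_Ioo zero_ne_one]
    exact t.2
  obtain ⟨s, hsW, hs⟩ := mem_closure_iff.1 hcl W hW ht
  obtain ⟨r, hr, hr'⟩ := Metric.isOpen_iff.1 (hW.inter isOpen_Ioo) s ⟨hsW, hs⟩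
  have h : ∀ v, |v - s| ≤ r / 2 → v ∈ W ∩ Ioo 0 1 := fun v hv =>
    hr' (by rw [Metric.mem_ball, Real.dist_eq]; linarith)
  have h1 := (h (s - r / 2) (by rw [abs_le]; constructor <;> linarith)).2.1
  have h2 := (h (s + r / 2) (by rw [abs_le]; constructor <;> linarith)).2.2
  exact ⟨s - r / 2, s + r / 2, h1, by linarith, h2, fun t h3 h4 =>
    (h t (by rw [abs_le]; constructor <;> linarith)).1⟩

/-- A box in the first `M` coordinates, contained in `U` and close to `x` in the first `m`
coordinates. -/
def HasNearBox (U : Set HilbertCube) (m M : ℕ) (ε : ℝ) (x : HilbertCube) : Prop :=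
  ∃ α β : ℕ → ℝ, (∀ l < M, 0 < α l ∧ α l < β l ∧ β l < 1) ∧
    (∀ l < m, |α l - x l| ≤ ε ∧ |β l - x l| ≤ ε) ∧
    ∀ q : HilbertCube, (∀ l < M, α l ≤ q l ∧ (q l : ℝ) ≤ β l) → q ∈ U

theorem exists_box_subset_of_isOpen {V : Set HilbertCube} (hV : IsOpen V) (hne : V.Nonempty) :
    ∃ M : ℕ, ∃ α β : ℕ → ℝ, (∀ l, 0 < α l ∧ α l < β l ∧ β l < 1) ∧
      ∀ q : HilbertCube, (∀ l < M, α l ≤ q l ∧ (q l : ℝ) ≤ β l) → q ∈ V := by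
  obtain ⟨c, hc⟩ := hne
  obtain ⟨I, u, hu, hIV⟩ := isOpen_pi_iff.1 hV c hc
  have : ∀ l, ∃ α β : ℝ, 0 < α ∧ α < β ∧ β < 1 ∧
      (l ∈ I → ∀ t : Icc (0 : ℝ) 1, α ≤ t → (t : ℝ) ≤ β → t ∈ u l) := by
    intro l
    by_cases hl : l ∈ I
    · obtain ⟨α, β, h1, h2, h3, h4⟩ := exists_Icc_subset_of_isOpen (hu l hl).1 ⟨_, (hu l hl).2⟩
      exact ⟨α, β, h1, h2, h3, fun _ => h4⟩
    · exact ⟨1 / 3, 2 / 3, by norm_num, by norm_num, by norm_num, fun h => absurd h hl⟩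
  choose α β h1 h2 h3 h4 using this
  refine ⟨I.sup id + 1, α, β, fun l => ⟨h1 l, h2 l, h3 l⟩, fun q hq => hIV fun l hl => ?_⟩
  have := hq l (Nat.lt_succ_of_le (Finset.le_sup (f := id) hl))
  exact h4 l hl _ this.1 this.2

theorem exists_hasNearBox {U : Set HilbertCube} (hU : IsOpen U) (hUd : Dense U) (m : ℕ) {ε : ℝ}
    (hε : 0 < ε) : ∃ M₀, ∀ M ≥ M₀, ∀ x, HasNearBox U m M ε x := by
  let B : HilbertCube → ℝ → Set HilbertCube := fun c r =>
    ⋂ l ∈ Finset.range m, {q | |(q l : ℝ) - c l| < r}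
  have hB : ∀ c r q, q ∈ B c r ↔ ∀ l < m, |(q l : ℝ) - c l| < r := fun c r q => by simp [B]
  have hBo : ∀ c r, IsOpen (B c r) := fun c r => isOpen_biInter_finset fun l _ =>
    isOpen_lt (by fun_prop) (by fun_prop)
  have hBc : ∀ c r, 0 < r → c ∈ B c r := fun c r hr => by simp [hB, hr]
  have key : ∀ c, ∃ M₀, ∀ M ≥ M₀, ∀ x ∈ B c (ε / 2), HasNearBox U m M ε x := by
    intro c
    obtain ⟨M, α, β, h1, h2⟩ := exists_box_subset_of_isOpen
      ((hBo c (ε / 2)).inter hU) (hUd.inter_open_nonempty _ (hBo c (ε / 2)) ⟨c, hBc c _ (by linarith)⟩)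
    have ha := (hB _ _ _).1 (h2 (fun l => ⟨α l, (h1 l).1.le, by linarith [h1 l]⟩) fun l _ =>
      ⟨le_rfl, (h1 l).2.1.le⟩).1
    have hb := (hB _ _ _).1 (h2 (fun l => ⟨β l, by linarith [h1 l], (h1 l).2.2.le⟩) fun l _ =>
      ⟨(h1 l).2.1.le, le_rfl⟩).1
    refine ⟨M, fun M' hM x hx => ⟨α, β, fun l _ => h1 l, fun l hl => ?_, fun q hq =>
      (h2 q fun l hl => hq l (by omega)).2⟩⟩
    have e1 := abs_lt.1 (ha l hl)
    have e2 := abs_lt.1 (hb l hl)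
    have e3 := abs_lt.1 ((hB _ _ _).1 hx l hl)
    simp only at e1 e2
    constructor <;> rw [abs_le] <;> constructor <;> linarith
  choose M₀ hM₀ using key
  obtain ⟨t, -, ht⟩ := isCompact_univ.elim_nhds_subcover (fun c => B c (ε / 2))
    fun c _ => (hBo c _).mem_nhds (hBc c _ (by linarith))
  refine ⟨t.sup M₀, fun M hM x => ?_⟩
  obtain ⟨c, hc, hx⟩ := mem_iUnion₂.1 (ht (mem_univ x))
  exact hM₀ c M ((Finset.le_sup hc).trans hM) x hx

theorem eventually_ne_of_disjoint {P Q : Set HilbertCube} (hP : IsClosed P) (hQ : IsClosed Q)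
    (hPQ : Disjoint P Q) (z y : ℕ) :
    ∀ᶠ N : ℕ in Filter.atTop, ∀ q ∈ P, ∀ q' ∈ Q, |(q z : ℝ) - q' z| < 1 / N →
      |(q y : ℝ) - q' y| < 1 / N → ∃ l, l ≠ z ∧ l ≠ y ∧ q l ≠ q' l := by
  let S : Set (HilbertCube × HilbertCube) :=
    (P ×ˢ Q) ∩ ⋂ l, ⋂ _ : l ≠ z ∧ l ≠ y, {p | p.1 l = p.2 l}
  have hS : IsCompact S := ((hP.prod hQ).inter (isClosed_iInter fun l => isClosed_iInter fun _ =>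
    isClosed_eq (by fun_prop) (by fun_prop))).isCompact
  let f : HilbertCube × HilbertCube → ℝ := fun p =>
    max |(p.1 z : ℝ) - p.2 z| |(p.1 y : ℝ) - p.2 y|
  obtain ⟨c, hc, hfc⟩ : ∃ c > 0, ∀ p ∈ S, c ≤ f p := by
    rcases S.eq_empty_or_nonempty with h | h
    · exact ⟨1, one_pos, by simp [h]⟩
    · obtain ⟨p, hp, hmin⟩ := hS.exists_isMinOn h (f := f)
        (Continuous.continuousOn (by simp only [f]; fun_prop))
      refine ⟨f p, ?_, fun p' hp' => hmin hp'⟩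
      by_contra hcon
      have hz : (p.1 z : ℝ) - p.2 z = 0 := abs_eq_zero.1 (le_antisymm
        ((le_max_left _ _).trans (not_lt.1 hcon)) (abs_nonneg _))
      have hy : (p.1 y : ℝ) - p.2 y = 0 := abs_eq_zero.1 (le_antisymm
        ((le_max_right _ _).trans (not_lt.1 hcon)) (abs_nonneg _))
      have : p.1 = p.2 := by
        funext l
        by_cases hlz : l = z
        · exact hlz ▸ Subtype.ext (sub_eq_zero.1 hz)
        by_cases hly : l = y
        · exact hly ▸ Subtype.ext (sub_eq_zero.1 hy)
        · exact mem_iInter₂.1 hp.2 l ⟨hlz, hly⟩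
      exact disjoint_left.1 hPQ hp.1.1 (this ▸ hp.1.2)
  obtain ⟨N₀, hN₀⟩ := exists_nat_one_div_lt hc
  filter_upwards [Filter.eventually_ge_atTop (N₀ + 1)] with N hN q hq q' hq' h1 h2
  by_contra hcon
  push Not at hcon
  have h3 := hfc (q, q') ⟨⟨hq, hq'⟩, mem_iInter₂.2 fun l hl => hcon l hl.1 hl.2⟩
  have h4 : f (q, q') < 1 / N := max_lt h1 h2
  have h5 : (1 : ℝ) / N ≤ 1 / (N₀ + 1) :=
    one_div_le_one_div_of_le (by positivity) (by exact_mod_cast hN)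
  linarith

theorem exists_homeomorphs_cover {C F : Set HilbertCube} (hC : IsClosed C) (hCF : C ⊆ F) {k : ℕ}
    (hdim : CovDimLE F k) {U : Fin (k + 4) → Set HilbertCube} (hU : ∀ e, IsOpen (U e))
    (hUd : ∀ e, Dense (U e)) (m : ℕ) {ε : ℝ} (hε : 0 < ε) :
    ∃ g : Fin (k + 4) → HilbertCube ≃ₜ HilbertCube,
      (∀ e q i, i < m → dist (g e q i) (q i) ≤ ε) ∧ C ⊆ ⋃ e, g e ⁻¹' U e := by
  classical
  choose M₀ hM₀ using fun e => exists_hasNearBox (hU e) (hUd e) m (ε := ε / 4) (by linarith)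
  obtain ⟨M, hM⟩ : ∃ M, M = max m (Finset.univ.sup M₀) := ⟨_, rfl⟩
  have hmM : m ≤ M := hM ▸ le_max_left _ _
  have hMe : ∀ e, M₀ e ≤ M := fun e =>
    hM ▸ (Finset.le_sup (Finset.mem_univ e)).trans (le_max_right _ _)
  obtain ⟨r, hr0, hrε, hr6⟩ : ∃ r : ℝ, 0 < r ∧ r ≤ ε / 4 ∧ r ≤ 1 / 6 :=
    ⟨min (ε / 4) (1 / 6), by positivity, min_le_left _ _, min_le_right _ _⟩
  let B : HilbertCube → Set HilbertCube := fun c =>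
    ⋂ l ∈ Finset.range (M + 3), {q | |(q l : ℝ) - c l| < r}
  have hB : ∀ c q, q ∈ B c ↔ ∀ l < M + 3, |(q l : ℝ) - c l| < r := fun c q => by simp [B]
  have hBo : ∀ c, IsOpen (B c) := fun c => isOpen_biInter_finset fun l _ =>
    isOpen_lt (by fun_prop) (by fun_prop)
  obtain ⟨t, -, ht⟩ := isCompact_univ.elim_nhds_subcover B
    fun c _ => (hBo c).mem_nhds (by simp [hB, hr0])
  obtain ⟨P, hP, hPC⟩ := exists_closed_pieces hC.isCompact hCF hdim
    (t.finite_toSet.image B) (by rintro _ ⟨c, -, rfl⟩; exact hBo c) (by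
      refine eq_univ_of_forall fun x => ?_
      obtain ⟨c, hc, hx⟩ := mem_iUnion₂.1 (ht (mem_univ x))
      exact ⟨_, ⟨c, hc, rfl⟩, hx⟩)
  have hPB : ∀ e, ∀ W ∈ P e, ∃ c, W ⊆ B c := fun e W hW => by
    obtain ⟨-, ⟨c, -, rfl⟩, hWc⟩ := ((hP e).2.1 W hW).2
    exact ⟨c, hWc⟩
  have hev : ∀ᶠ N : ℕ in Filter.atTop, ∀ e ∈ Iio (k + 4), ∀ W ∈ P e, ∀ W' ∈ P e, W ≠ W' →
      ∀ q ∈ W, ∀ q' ∈ W', |(q M : ℝ) - q' M| < 1 / N →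
      |(q (M + 1) : ℝ) - q' (M + 1)| < 1 / N → ∃ l, l ≠ M ∧ l ≠ M + 1 ∧ q l ≠ q' l := by
    refine (Filter.eventually_all_finite (finite_Iio _)).2 fun e _ =>
      (Filter.eventually_all_finite (hP e).1).2 fun W hW =>
      (Filter.eventually_all_finite (hP e).1).2 fun W' hW' => ?_
    by_cases h : W = W'
    · exact Filter.Eventually.of_forall fun N hN => absurd h hN
    · filter_upwards [eventually_ne_of_disjoint ((hP e).2.1 W hW).1 ((hP e).2.1 W' hW').1
        ((hP e).2.2 hW hW' h) M (M + 1)] with N hN _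
      exact hN
  obtain ⟨N, hN, hN0⟩ := (hev.and (Filter.eventually_gt_atTop 0)).exists
  obtain ⟨J, O, hJ1, hJ2, hJ3, hJ4⟩ := exists_cells (k + 4) N hN0
  have step : ∀ e : Fin (k + 4), ∃ g : HilbertCube ≃ₜ HilbertCube,
      (∀ q, ∀ l < m, |(g q l : ℝ) - q l| ≤ 4 * (ε / 4)) ∧
      ∀ W : P e, ∀ q ∈ W.1, (∃ a : Fin (N + 1) × Fin (N + 1),
        (q M, q (M + 1)) ∈ J e a.1 ×ˢ J e a.2) → g q ∈ U e := by
    intro e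
    have : Finite (P e) := (hP e).1
    refine exists_homeomorph_pieces_into hmM (by linarith)
      (κ := fun a : Fin (N + 1) × Fin (N + 1) => J e a.1 ×ˢ J e a.2)
      (O := fun a => O e a.1 ×ˢ O e a.2) (fun a => (hJ1 e e.2 a.1).1.prod (hJ1 e e.2 a.2).1)
      (fun a => prod_mono (hJ1 e e.2 a.1).2.2.1 (hJ1 e e.2 a.2).2.2.1)
      (fun a => (hJ1 e e.2 a.1).isDisplaceable_prod (hJ1 e e.2 a.2)) ?_
      (P := fun W : P e => W.1) (fun W => ((hP e).2.1 W.1 W.2).1) ?_ ?_ ?_ (hM₀ e M (hMe e))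
    · rintro ⟨a, b⟩ ⟨a', b'⟩ hab
      refine disjoint_left.2 fun p hp hp' => hab ?_
      by_contra hne
      rw [Prod.mk.injEq, not_and_or] at hne
      rcases hne with h | h
      · exact disjoint_left.1 (hJ2 e h) hp.1 hp'.1
      · exact disjoint_left.1 (hJ2 e h) hp.2 hp'.2
    · intro W W' hWW a q hq q' hq' ha ha'
      exact hN e e.2 W.1 W.2 W'.1 W'.2 (fun h => hWW (Subtype.ext h)) q hq q' hq'
        (hJ3 e a.1 _ ha.1 _ ha'.1) (hJ3 e a.2 _ ha.2 _ ha'.2)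
    · intro W
      obtain ⟨c, hc⟩ := hPB e W.1 W.2
      exact ⟨c, fun q hq l hl => ((hB _ _).1 (hc hq) l (by omega)).le.trans hrε⟩
    · intro W
      obtain ⟨c, hc⟩ := hPB e W.1 W.2
      rcases le_total (c (M + 2) : ℝ) (1 / 2) with h | h
      · refine Or.inl fun q hq => ?_
        have := abs_lt.1 ((hB _ _).1 (hc hq) (M + 2) (by omega))
        linarith
      · refine Or.inr fun q hq => ?_
        have := abs_lt.1 ((hB _ _).1 (hc hq) (M + 2) (by omega))
        linarith
  choose g hg1 hg2 using step
  refine ⟨g, fun e q i hi => ?_, fun q hq => ?_⟩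
  · rw [Subtype.dist_eq, Real.dist_eq]
    linarith [hg1 e q i hi]
  · obtain ⟨T, hT, hT4, hTP⟩ := hPC q hq
    have hbad : ∀ s : Icc (0 : ℝ) 1, (T.filter fun e => ¬ ∃ a, s ∈ J e a).card ≤ 1 := by
      intro s
      rw [Finset.card_le_one]
      intro e he e' he'
      rw [Finset.mem_filter] at he he'
      by_contra hne
      exact (hJ4 s e (Finset.mem_range.1 (hT he.1)) e' (Finset.mem_range.1 (hT he'.1)) hne).elim
        he.2 he'.2
    obtain ⟨e, heT, ⟨a, ha⟩, b, hb⟩ : ∃ e ∈ T, (∃ a, q M ∈ J e a) ∧ ∃ b, q (M + 1) ∈ J e b := by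
      by_contra hcon
      push Not at hcon
      have hsub : T ⊆ (T.filter fun e => ¬ ∃ a, q M ∈ J e a) ∪
          T.filter fun e => ¬ ∃ a, q (M + 1) ∈ J e a := by
        intro e he
        by_cases h : ∃ a, q M ∈ J e a
        · obtain ⟨a, ha⟩ := h
          exact Finset.mem_union_right _ (Finset.mem_filter.2 ⟨he, by
            push Not; exact hcon e he ⟨a, ha⟩⟩)
        · exact Finset.mem_union_left _ (Finset.mem_filter.2 ⟨he, h⟩)
      have h1 := (Finset.card_le_card hsub).trans (Finset.card_union_le _ _)
      have h2 := hbad (q M)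
      have h3 := hbad (q (M + 1))
      omega
    obtain ⟨W, hW, hqW⟩ := hTP e heT
    exact mem_iUnion.2 ⟨⟨e, Finset.mem_range.1 (hT heT)⟩,
      hg2 ⟨e, Finset.mem_range.1 (hT heT)⟩ ⟨W, hW⟩ q hqW ⟨(a, b), ha, hb⟩⟩

/-- For every dense `G_δ`-set `G` in the Hilbert cube and every `F_σ`-set `F` of
covering dimension at most `k`, the set `H^{k+4}_{F,G}` is a dense `G_δ` in
`H(I^ω)^{k+4}`. -/
theorem H_F_G_denseGdelta_of_Fsigma (G F : Set HilbertCube)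
    (hG : IsGδ G) (hGd : Dense G)
    (hF : ∃ C : ℕ → Set HilbertCube, (∀ n, IsClosed (C n)) ∧ F = ⋃ n, C n)
    (k : ℕ) (hdim : CovDimLE ↥F k) :
    IsGδ {h : Fin (k + 4) → HilbertCube ≃ₜ HilbertCube | F ⊆ ⋃ i, (h i) '' G} ∧
    Dense {h : Fin (k + 4) → HilbertCube ≃ₜ HilbertCube | F ⊆ ⋃ i, (h i) '' G} :=
  main_of_approx G F hG hGd hF (k + 4) fun _ hC hCF _ hU hUd m _ hε =>
    exists_homeomorphs_cover hC hCF hdim hU hUd m hε
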